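/- For every α ∈ (0,1/2) and every f ∈ 𝒲₁: (i) 𝔗_α(f) is differentiable on (0,∞) and x·𝔗_α(f)'(x) ≤ 2·𝔗_α(f)(x) for all x > 0; (ii) the function x ↦ 𝔗_α(f)(x)/x² is non-increasing on (0,∞); (iii) 𝔗_α(f)(x)/x² ≤ 𝔠(f)/2 for all x > 0; and (iv) 𝔗_α(f)(x) ≤ min(𝔟(f), (𝔠(f)/2)·x²) for all x > 0. -/

import Mathlib

open Real MeasureTheory Set Filter BoundedContinuousFunction

noncomputable section

namespace GSQGhalfplane

/-- The constant `c_{0,α} = 2^{2α-1} Γ(1+α) / (π Γ(1-α))`. -/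
def C0 (α : ℝ) : ℝ := (2:ℝ) ^ (2*α - 1) * Real.Gamma (1 + α) / (π * Real.Gamma (1 - α))

/-- The constant `c'''_{0,α}`. -/
def C3 (α : ℝ) : ℝ :=
  ((4:ℝ) ^ (1 + α) - 4 + α - 4*α^3) * Real.Gamma α /
    (2*π*α*(5 - 2*α)*(3 - 2*α)*(1 - 2*α)*Real.Gamma (2 - α))

/-- The exponent `δ_u = c'''_{0,α} t₀^{1/2-α} / (1 + c'''_{0,α} t₀^{1/2-α})`. -/
def deltaU (α t0 : ℝ) : ℝ :=
  C3 α * t0 ^ (1/2 - α) / (1 + C3 α * t0 ^ (1/2 - α))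

/-- The lower barrier `f_l(x) = (1 + t₀^{-2} x²)^{-δ_l}`. -/
def fl (t0 δl x : ℝ) : ℝ := (1 + x^2 / t0^2) ^ (-δl)

/-- The upper barrier `f_u(x) = min(1, t₀^{δ_u} |x|^{-δ_u})` (with value `1` at `x = 0`). -/
def fu (α t0 x : ℝ) : ℝ :=
  if x = 0 then 1 else min 1 (t0 ^ deltaU α t0 * |x| ^ (-(deltaU α t0)))

/-- The invariant set `𝒲₁`: even continuous bounded functions with `f(0)=1`,
nonnegative and non-increasing on `[0,∞)`, `x ↦ f(√x)` convex,
`f_l ≤ f ≤ f_u`, and left derivative at `t₀` at most `-t₀^{α-3/2}`. -/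
def W1 (α t0 δl : ℝ) (f : ℝ → ℝ) : Prop :=
  Continuous f ∧ (∃ M : ℝ, ∀ x : ℝ, |f x| ≤ M) ∧ (∀ x : ℝ, f (-x) = f x) ∧
  f 0 = 1 ∧ (∀ x ∈ Ici (0:ℝ), 0 ≤ f x) ∧ AntitoneOn f (Ici (0:ℝ)) ∧
  ConvexOn ℝ (Ici (0:ℝ)) (fun x => f (Real.sqrt x)) ∧
  (∀ x : ℝ, fl t0 δl x ≤ f x) ∧ (∀ x : ℝ, f x ≤ fu α t0 x) ∧
  (∃ d : ℝ, HasDerivWithinAt f d (Iio t0) t0 ∧ d ≤ -(t0 ^ (α - 3/2)))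

/-- The linear operator `𝔗_α(f)`, defined for `x > 0`, set to `0` at `x = 0`,
and extended evenly to `ℝ` (via `|x|`). -/
def Tfr (α : ℝ) (f : ℝ → ℝ) (x : ℝ) : ℝ :=
  if x = 0 then 0
  else (C0 α / α) * ∫ ξ in Ioi (0:ℝ),
    f ξ * (4*α * ξ ^ (-(2*α)) - (ξ / |x|) * (|(|x| - ξ)| ^ (-(2*α)) - (|x| + ξ) ^ (-(2*α))))

/-- The nonlinear map `ℜ_α(f)(x) = exp(-∫₀^{|x|} 𝔗_α(f)(y)/(y(1+𝔗_α(f)(y))) dy)`. -/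
def Rfr (α : ℝ) (f : ℝ → ℝ) (x : ℝ) : ℝ :=
  Real.exp (-(∫ y in (0:ℝ)..|x|, Tfr α f y / (y * (1 + Tfr α f y))))

/-- The functional `𝔟(f) = 4 c_{0,α} ∫₀^∞ f(ξ) ξ^{-2α} dξ`. -/
def bfr (α : ℝ) (f : ℝ → ℝ) : ℝ := 4 * C0 α * ∫ ξ in Ioi (0:ℝ), f ξ * ξ ^ (-(2*α))

/-- The functional `𝔠(f) = (8(1+2α)(1+α)/3) c_{0,α} ∫₀^∞ (1-f(ξ)) ξ^{-2-2α} dξ`. -/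
def cfr (α : ℝ) (f : ℝ → ℝ) : ℝ :=
  (8*(1+2*α)*(1+α)/3) * C0 α * ∫ ξ in Ioi (0:ℝ), (1 - f ξ) * ξ ^ (-2 - 2*α)

/-- The lower bound `b'_α`. -/
def bLow (α t0 δl : ℝ) : ℝ :=
  2 * C0 α * t0 ^ (1 - 2*α) * Real.Gamma (1/2 - α) * Real.Gamma (α + δl - 1/2) /
    Real.Gamma δl

/-- The upper bound `b''_α`. -/
def bHigh (α t0 : ℝ) : ℝ :=
  4 * C0 α * t0 ^ (1 - 2*α) * (1/(1 - 2*α) + 1/(deltaU α t0 + 2*α - 1))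

/-- The upper bound `c''_{0,α}`. -/
def cHigh (α t0 δl : ℝ) : ℝ :=
  C0 α * t0 ^ (-1 - 2*α) * 8 * (1 + α) * Real.Gamma (1/2 - α) *
    Real.Gamma (δl + α + 1/2) / (3 * Real.Gamma δl)

open scoped Topology Asymptotics

lemma isBigO_pow_succ_of_hasDerivAt {φ φ' : ℝ → ℝ} {n : ℕ}
    (hd : ∀ᶠ u in 𝓝 (0:ℝ), HasDerivAt φ (φ' u) u) (h0 : φ 0 = 0)
    (hO : φ' =O[𝓝 0] fun u => u ^ n) : φ =O[𝓝 0] fun u => u ^ (n + 1) := by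
  obtain ⟨C, hC⟩ := hO.bound
  obtain ⟨r, hr, hball⟩ := Metric.eventually_nhds_iff_ball.1 (hd.and hC)
  refine Asymptotics.IsBigO.of_bound C ?_
  filter_upwards [Metric.ball_mem_nhds (0:ℝ) hr] with u hu
  have hsub : segment ℝ 0 u ⊆ Metric.ball (0:ℝ) r :=
    (convex_ball 0 r).segment_subset (Metric.mem_ball_self hr) hu
  have hle : ∀ v ∈ segment ℝ 0 u, |v| ≤ |u| := by
    intro v hv
    have := norm_sub_le_of_mem_segment hv
    simpa using this
  have := Convex.norm_image_sub_le_of_norm_hasDerivWithin_le (f := φ) (f' := φ')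
    (s := segment ℝ 0 u) (C := C * |u| ^ n)
    (fun v hv => (hball v (hsub hv)).1.hasDerivWithinAt)
    (fun v hv => by
      have h2 := (hball v (hsub hv)).2
      have hC0 : C * |v| ^ n ≤ C * |u| ^ n := by
        rcases le_or_gt 0 C with h | h
        · exact mul_le_mul_of_nonneg_left (pow_le_pow_left₀ (abs_nonneg v) (hle v hv) n) h
        · have h3 := (hball u hu).2
          have h4 : ‖u ^ n‖ = 0 := by
            by_contra hne
            have : 0 < ‖u ^ n‖ := lt_of_le_of_ne (norm_nonneg _) (Ne.symm hne)
            have := norm_nonneg (φ' u)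
            nlinarith
          rw [norm_pow, Real.norm_eq_abs] at h4
          rw [h4, mul_zero]
          have : 0 ≤ |v| ^ n := by positivity
          nlinarith [norm_nonneg (φ' v), (norm_pow v n), Real.norm_eq_abs v]
      rw [norm_pow, Real.norm_eq_abs v] at h2
      exact h2.trans hC0)
    (convex_segment 0 u) (left_mem_segment ℝ 0 u) (right_mem_segment ℝ 0 u)
  simp only [h0, sub_zero, Real.norm_eq_abs] at this
  simpa [pow_succ, mul_assoc, abs_mul, abs_pow] using this

lemma hasDerivAt_one_add_rpow (p : ℝ) :
    ∀ᶠ u in 𝓝 (0:ℝ), HasDerivAt (fun u : ℝ => (1 + u) ^ p) (p * (1 + u) ^ (p - 1)) u := by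
  filter_upwards [lt_mem_nhds (show (-1:ℝ) < 0 by norm_num)] with u hu
  have := ((hasDerivAt_id u).const_add 1).rpow_const (p := p) (Or.inl (by simp; linarith))
  simpa using this

lemma one_add_rpow_taylor (p : ℝ) :
    (fun u : ℝ => (1 + u) ^ p - (1 + p * u + p * (p - 1) / 2 * u ^ 2
      + p * (p - 1) * (p - 2) / 6 * u ^ 3
      + p * (p - 1) * (p - 2) * (p - 3) / 24 * u ^ 4)) =O[𝓝 0] fun u => u ^ 5 := by
  have h1 : ∀ p : ℝ, (fun u : ℝ => (1 + u) ^ p - 1) =O[𝓝 0] fun u => u ^ 1 := by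
    intro p
    refine isBigO_pow_succ_of_hasDerivAt (n := 0) (φ' := fun u => p * (1 + u) ^ (p - 1)) ?_
      (by simp) ?_
    · filter_upwards [hasDerivAt_one_add_rpow p] with u hu
      simpa using hu.sub_const 1
    · have : ContinuousAt (fun u : ℝ => p * (1 + u) ^ (p - 1)) 0 := by
        refine continuousAt_const.mul (ContinuousAt.rpow_const (by fun_prop) (Or.inl (by simp)))
      simpa using this.isBigO_one ℝ
  have h2 : ∀ p : ℝ, (fun u : ℝ => (1 + u) ^ p - (1 + p * u)) =O[𝓝 0] fun u => u ^ 2 := by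
    intro p
    refine isBigO_pow_succ_of_hasDerivAt (n := 1) ?_ (by simp) ((h1 (p - 1)).const_mul_left p)
    filter_upwards [hasDerivAt_one_add_rpow p] with u hu
    refine (hu.sub (((hasDerivAt_id u).const_mul p).const_add 1)).congr_deriv ?_
    ring
  have h3 : ∀ p : ℝ, (fun u : ℝ => (1 + u) ^ p - (1 + p * u + p * (p - 1) / 2 * u ^ 2))
      =O[𝓝 0] fun u => u ^ 3 := by
    intro p
    refine isBigO_pow_succ_of_hasDerivAt (n := 2) ?_ (by simp) ((h2 (p - 1)).const_mul_left p)
    filter_upwards [hasDerivAt_one_add_rpow p] with u hu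
    refine (hu.sub ((((hasDerivAt_id u).const_mul p).const_add 1).add
      ((hasDerivAt_pow 2 u).const_mul (p * (p - 1) / 2)))).congr_deriv ?_
    simp; ring
  have h4 : ∀ p : ℝ, (fun u : ℝ => (1 + u) ^ p - (1 + p * u + p * (p - 1) / 2 * u ^ 2
      + p * (p - 1) * (p - 2) / 6 * u ^ 3)) =O[𝓝 0] fun u => u ^ 4 := by
    intro p
    refine isBigO_pow_succ_of_hasDerivAt (n := 3) ?_ (by simp) ((h3 (p - 1)).const_mul_left p)
    filter_upwards [hasDerivAt_one_add_rpow p] with u hu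
    refine (hu.sub (((((hasDerivAt_id u).const_mul p).const_add 1).add
      ((hasDerivAt_pow 2 u).const_mul (p * (p - 1) / 2))).add
      ((hasDerivAt_pow 3 u).const_mul (p * (p - 1) * (p - 2) / 6)))).congr_deriv ?_
    simp; ring
  refine isBigO_pow_succ_of_hasDerivAt (n := 4) ?_ (by simp) ((h4 (p - 1)).const_mul_left p)
  filter_upwards [hasDerivAt_one_add_rpow p] with u hu
  refine (hu.sub ((((((hasDerivAt_id u).const_mul p).const_add 1).add
    ((hasDerivAt_pow 2 u).const_mul (p * (p - 1) / 2))).add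
    ((hasDerivAt_pow 3 u).const_mul (p * (p - 1) * (p - 2) / 6))).add
    ((hasDerivAt_pow 4 u).const_mul (p * (p - 1) * (p - 2) * (p - 3) / 24)))).congr_deriv ?_
  simp; ring

lemma one_sub_rpow_taylor (p : ℝ) :
    (fun u : ℝ => (1 - u) ^ p - (1 - p * u + p * (p - 1) / 2 * u ^ 2
      - p * (p - 1) * (p - 2) / 6 * u ^ 3
      + p * (p - 1) * (p - 2) * (p - 3) / 24 * u ^ 4)) =O[𝓝 0] fun u => u ^ 5 := by
  have ht : Tendsto (fun u : ℝ => -u) (𝓝 0) (𝓝 0) := by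
    simpa using (continuous_neg (G := ℝ)).tendsto 0
  have := (one_add_rpow_taylor p).comp_tendsto ht
  refine (this.congr' ?_ (EventuallyEq.rfl)).trans ?_
  · filter_upwards with u
    simp only [Function.comp]
    rw [← sub_eq_add_neg]; ring
  · exact Asymptotics.IsBigO.of_bound 1 (by filter_upwards with u; simp)

/-- The kernel on either side of its singularity at `1` (`σ = 1` on the right, `σ = -1` on the
left). -/
def mS (β σ t : ℝ) : ℝ := t * (σ * (t - 1)) ^ (-β) - t * (1 + t) ^ (-β) - 2 * β * t ^ (-β)

/-- A primitive of `mS`. -/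
def eS (β σ t : ℝ) : ℝ :=
  ((σ * (t - 1)) ^ (2 - β) - (1 + t) ^ (2 - β)) / (2 - β)
    + (σ * (σ * (t - 1)) ^ (1 - β) + (1 + t) ^ (1 - β)) / (1 - β) - 2 * β * t ^ (1 - β) / (1 - β)

/-- A primitive of `t ↦ t * eS β σ t`. -/
def fS (β σ t : ℝ) : ℝ :=
  (((σ * (t - 1)) ^ (4 - β) - (1 + t) ^ (4 - β)) / (4 - β)
    + (σ * (σ * (t - 1)) ^ (3 - β) + (1 + t) ^ (3 - β)) / (3 - β)) / (2 - β)
  + ((σ * (σ * (t - 1)) ^ (3 - β) + (1 + t) ^ (3 - β)) / (3 - β)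
    + ((σ * (t - 1)) ^ (2 - β) - (1 + t) ^ (2 - β)) / (2 - β)) / (1 - β)
  - 2 * β * t ^ (3 - β) / ((1 - β) * (3 - β))

/-- A primitive of `t ↦ t * nS β σ t`. -/
def rS (β σ t : ℝ) : ℝ := -t ^ 2 * eS β σ t + (1 - β) * fS β σ t

/-- Minus the derivative of `t ^ (1 + β) * eS β σ t`, divided by `t ^ β`. -/
def nS (β σ t : ℝ) : ℝ := -((1 + β) * eS β σ t + t * mS β σ t)

section primitives
variable {β σ t : ℝ}

lemma hasDerivAt_left_rpow (p : ℝ) (h : 0 < σ * (t - 1)) :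
    HasDerivAt (fun t => (σ * (t - 1)) ^ p) (σ * p * (σ * (t - 1)) ^ (p - 1)) t := by
  have := (((hasDerivAt_id t).sub_const 1).const_mul σ).rpow_const (p := p) (Or.inl h.ne')
  simpa using this

lemma hasDerivAt_right_rpow (p : ℝ) (h : 0 < t) :
    HasDerivAt (fun t => (1 + t) ^ p) (p * (1 + t) ^ (p - 1)) t := by
  have := ((hasDerivAt_id t).const_add 1).rpow_const (p := p) (Or.inl (by simp; linarith))
  simpa using this

lemma hasDerivAt_self_rpow (p : ℝ) (h : 0 < t) :
    HasDerivAt (fun t => t ^ p) (p * t ^ (p - 1)) t :=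
  Real.hasDerivAt_rpow_const (Or.inl h.ne')

lemma rpow_nat_sub {a : ℝ} (ha : 0 < a) (n : ℕ) (β : ℝ) : a ^ ((n:ℝ) - β) = a ^ n * a ^ (-β) := by
  rw [sub_eq_add_neg, rpow_add ha, rpow_natCast]

lemma hasDerivAt_eS (hβ : β ∈ Ioo (0:ℝ) 1) (hσ : σ = 1 ∨ σ = -1) (ht : 0 < t)
    (h : 0 < σ * (t - 1)) : HasDerivAt (eS β σ) (mS β σ t) t := by
  have h1 : 1 - β ≠ 0 := by linarith [hβ.2]
  have h2 : 2 - β ≠ 0 := by linarith [hβ.2]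
  have := (((hasDerivAt_left_rpow (2 - β) h).sub (hasDerivAt_right_rpow (2 - β) ht)).div_const
    (2 - β)).add ((((hasDerivAt_left_rpow (1 - β) h).const_mul σ).add
      (hasDerivAt_right_rpow (1 - β) ht)).div_const (1 - β)) |>.sub
      (((hasDerivAt_self_rpow (1 - β) ht).const_mul (2 * β)).div_const (1 - β))
  refine this.congr_deriv ?_
  have e1 : ∀ a : ℝ, 0 < a → a ^ (2 - β - 1) = a * a ^ (-β) := fun a ha => by
    rw [show 2 - β - 1 = ((1:ℕ):ℝ) - β by push_cast; ring, rpow_nat_sub ha, pow_one]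
  have e0 : ∀ a : ℝ, a ^ (1 - β - 1) = a ^ (-β) := fun a => by ring_nf
  rw [e1 _ h, e1 _ (by linarith : (0:ℝ) < 1 + t), e0, e0, e0, mS]
  field_simp
  rcases hσ with rfl | rfl <;> ring

lemma hasDerivAt_fS (hβ : β ∈ Ioo (0:ℝ) 1) (hσ : σ = 1 ∨ σ = -1) (ht : 0 < t)
    (h : 0 < σ * (t - 1)) : HasDerivAt (fS β σ) (t * eS β σ t) t := by
  have h1 : 1 - β ≠ 0 := by linarith [hβ.2]
  have h2 : 2 - β ≠ 0 := by linarith [hβ.2]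
  have h3 : 3 - β ≠ 0 := by linarith [hβ.2]
  have h4 : 4 - β ≠ 0 := by linarith [hβ.2]
  have k3 := (((hasDerivAt_left_rpow (3 - β) h).const_mul σ).add
      (hasDerivAt_right_rpow (3 - β) ht)).div_const (3 - β)
  have := ((((((hasDerivAt_left_rpow (4 - β) h).sub (hasDerivAt_right_rpow (4 - β) ht)).div_const
    (4 - β)).add k3).div_const (2 - β)).add ((k3.add
    (((hasDerivAt_left_rpow (2 - β) h).sub (hasDerivAt_right_rpow (2 - β) ht)).div_const
    (2 - β))).div_const (1 - β))).sub
      (((hasDerivAt_self_rpow (3 - β) ht).const_mul (2 * β)).div_const ((1 - β) * (3 - β)))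
  refine this.congr_deriv ?_
  have ht1 : (0:ℝ) < 1 + t := by linarith
  have e3 : ∀ a : ℝ, 0 < a → a ^ (4 - β - 1) = a ^ 3 * a ^ (-β) := fun a ha => by
    rw [show 4 - β - 1 = ((3:ℕ):ℝ) - β by push_cast; ring, rpow_nat_sub ha]
  have e2 : ∀ a : ℝ, 0 < a → a ^ (3 - β - 1) = a ^ 2 * a ^ (-β) := fun a ha => by
    rw [show 3 - β - 1 = ((2:ℕ):ℝ) - β by push_cast; ring, rpow_nat_sub ha]
  have e1 : ∀ a : ℝ, 0 < a → a ^ (2 - β - 1) = a * a ^ (-β) := fun a ha => by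
    rw [show 2 - β - 1 = ((1:ℕ):ℝ) - β by push_cast; ring, rpow_nat_sub ha, pow_one]
  have g2 : ∀ a : ℝ, 0 < a → a ^ (2 - β) = a ^ 2 * a ^ (-β) := fun a ha => by
    rw [show 2 - β = ((2:ℕ):ℝ) - β by push_cast; ring, rpow_nat_sub ha]
  have g1 : ∀ a : ℝ, 0 < a → a ^ (1 - β) = a * a ^ (-β) := fun a ha => by
    rw [show 1 - β = ((1:ℕ):ℝ) - β by push_cast; ring, rpow_nat_sub ha, pow_one]
  rw [eS, e3 _ h, e3 _ ht1, e2 _ h, e2 _ ht1, e2 _ ht, e1 _ h, e1 _ ht1, g2 _ h, g2 _ ht1, g1 _ h,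
    g1 _ ht1, g1 _ ht]
  field_simp
  rcases hσ with rfl | rfl <;> ring

lemma hasDerivAt_rS (hβ : β ∈ Ioo (0:ℝ) 1) (hσ : σ = 1 ∨ σ = -1) (ht : 0 < t)
    (h : 0 < σ * (t - 1)) : HasDerivAt (rS β σ) (t * nS β σ t) t := by
  have := (((hasDerivAt_pow 2 t).neg).mul (hasDerivAt_eS hβ hσ ht h)).add
    ((hasDerivAt_fS hβ hσ ht h).const_mul (1 - β))
  refine this.congr_deriv ?_
  simp [nS]; ring

lemma continuous_eS (hβ : β ∈ Ioo (0:ℝ) 1) : Continuous (eS β σ) := by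
  have h1 : 0 ≤ 1 - β := by linarith [hβ.2]
  have h2 : 0 ≤ 2 - β := by linarith [hβ.2]
  unfold eS
  fun_prop (disch := assumption)

lemma continuous_rS (hβ : β ∈ Ioo (0:ℝ) 1) : Continuous (rS β σ) := by
  have h1 : 0 ≤ 1 - β := by linarith [hβ.2]
  have h2 : 0 ≤ 2 - β := by linarith [hβ.2]
  have h3 : 0 ≤ 3 - β := by linarith [hβ.2]
  have h4 : 0 ≤ 4 - β := by linarith [hβ.2]
  have := continuous_eS (σ := σ) hβ
  unfold rS fS
  fun_prop (disch := assumption)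

lemma eS_one (hβ : β ∈ Ioo (0:ℝ) 1) : eS β σ 1 = eS β 1 1 := by
  have h1 : 1 - β ≠ 0 := by linarith [hβ.2]
  simp [eS, h1]

lemma rS_one (hβ : β ∈ Ioo (0:ℝ) 1) : rS β σ 1 = rS β 1 1 := by
  have h1 : 1 - β ≠ 0 := by linarith [hβ.2]
  have h3 : 3 - β ≠ 0 := by linarith [hβ.2]
  simp [rS, fS, eS_one (σ := σ) hβ, h3]

lemma eS_zero (hβ : β ∈ Ioo (0:ℝ) 1) : eS β (-1) 0 = 0 := by
  have h1 : 1 - β ≠ 0 := by linarith [hβ.2]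
  simp [eS, h1]

lemma rS_zero (hβ : β ∈ Ioo (0:ℝ) 1) : rS β (-1) 0 = 0 := by
  have h1 : 1 - β ≠ 0 := by linarith [hβ.2]
  have h3 : 3 - β ≠ 0 := by linarith [hβ.2]
  simp [rS, fS, h3]

end primitives

section asymptotics
variable {β : ℝ}

lemma isBigO_rpow_mul_comp_inv {g : ℝ → ℝ} {n : ℕ} (p : ℝ) (hg : g =O[𝓝 0] fun u => u ^ n) :
    (fun t : ℝ => t ^ p * g t⁻¹) =O[atTop] fun t => t ^ (p - n) := by
  have h1 := hg.comp_tendsto (tendsto_inv_atTop_zero (𝕜 := ℝ))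
  refine ((Asymptotics.isBigO_refl (fun t : ℝ => t ^ p) atTop).mul h1).congr' EventuallyEq.rfl ?_
  filter_upwards [eventually_gt_atTop 0] with t ht
  simp only [Function.comp]
  rw [rpow_sub ht, rpow_natCast, inv_pow, div_eq_mul_inv]

lemma sub_one_rpow_eq {t : ℝ} (ht : 1 < t) (p : ℝ) :
    (1 * (t - 1)) ^ p = t ^ p * (1 - t⁻¹) ^ p := by
  have : t⁻¹ ≤ 1 := inv_le_one_of_one_le₀ ht.le
  rw [← mul_rpow (by linarith) (by linarith)]
  congr 1
  field_simp

lemma one_add_rpow_eq {t : ℝ} (ht : 1 < t) (p : ℝ) :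
    (1 + t) ^ p = t ^ p * (1 + t⁻¹) ^ p := by
  have : 0 < t⁻¹ := inv_pos.2 (by linarith)
  rw [← mul_rpow (by linarith) (by linarith)]
  congr 1
  field_simp
  ring

lemma isBigO_pow_of_le {m n : ℕ} (h : n ≤ m) (c : ℝ) :
    (fun u : ℝ => c * u ^ m) =O[𝓝 0] fun u => u ^ n := by
  have h1 : (fun u : ℝ => u ^ (m - n)) =O[𝓝 0] fun _ => (1:ℝ) :=
    ((continuous_pow (m - n)).tendsto (0:ℝ)).isBigO_one ℝ
  refine (((Asymptotics.isBigO_refl (fun u : ℝ => u ^ n) (𝓝 0)).mul h1).congr (fun u => ?_)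
    (fun u => mul_one _)).const_mul_left c
  rw [← pow_add, Nat.add_sub_cancel' h]

lemma mS_one_eq {t : ℝ} (ht : 1 < t) : mS β 1 t =
    t ^ (1 - β) * ((1 - t⁻¹) ^ (-β) - (1 + t⁻¹) ^ (-β) - 2 * β * t⁻¹) := by
  have h0 : 0 < t := by linarith
  rw [mS, sub_one_rpow_eq ht, one_add_rpow_eq ht, sub_eq_add_neg 1 β, rpow_add h0, rpow_one]
  field_simp

lemma eS_one_eq {t : ℝ} (ht : 1 < t) : eS β 1 t = t ^ (2 - β) *
    (((1 - t⁻¹) ^ (2 - β) - (1 + t⁻¹) ^ (2 - β)) / (2 - β)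
      + t⁻¹ * ((1 - t⁻¹) ^ (1 - β) + (1 + t⁻¹) ^ (1 - β)) / (1 - β)
      - 2 * β * t⁻¹ / (1 - β)) := by
  have h0 : 0 < t := by linarith
  rw [eS, sub_one_rpow_eq ht, one_add_rpow_eq ht, sub_one_rpow_eq ht, one_add_rpow_eq ht,
    show t ^ (2 - β) = t ^ (1 - β) * t by
      rw [show 2 - β = 1 - β + 1 by ring, rpow_add h0, rpow_one]]
  have : t * t⁻¹ = 1 := mul_inv_cancel₀ h0.ne'
  linear_combination (-((1 - t⁻¹) ^ (1 - β) + (1 + t⁻¹) ^ (1 - β)) / (1 - β)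
    + 2 * β / (1 - β)) * t ^ (1 - β) * this

lemma fS_one_eq {t : ℝ} (ht : 1 < t) : fS β 1 t = t ^ (4 - β) *
    ((((1 - t⁻¹) ^ (4 - β) - (1 + t⁻¹) ^ (4 - β)) / (4 - β)
      + t⁻¹ * ((1 - t⁻¹) ^ (3 - β) + (1 + t⁻¹) ^ (3 - β)) / (3 - β)) / (2 - β)
    + (t⁻¹ * ((1 - t⁻¹) ^ (3 - β) + (1 + t⁻¹) ^ (3 - β)) / (3 - β)
      + t⁻¹ ^ 2 * ((1 - t⁻¹) ^ (2 - β) - (1 + t⁻¹) ^ (2 - β)) / (2 - β)) / (1 - β)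
      - 2 * β * t⁻¹ / ((1 - β) * (3 - β))) := by
  have h0 : 0 < t := by linarith
  have h3 : t ^ (3 - β) = t ^ (4 - β) * t⁻¹ := by
    rw [show 3 - β = 4 - β - 1 by ring, rpow_sub h0, rpow_one, div_eq_mul_inv]
  have h2 : t ^ (2 - β) = t ^ (4 - β) * t⁻¹ ^ 2 := by
    rw [show 2 - β = 4 - β - (2:ℕ) by push_cast; ring, rpow_sub h0, rpow_natCast, div_eq_mul_inv,
      inv_pow]
  rw [fS]
  simp only [sub_one_rpow_eq ht, one_add_rpow_eq ht]
  rw [h3, h2]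
  ring

lemma mS_isBigO : (fun t => mS β 1 t - β * (β + 1) * (β + 2) / 3 * t ^ (-2 - β)) =O[atTop]
    fun t => t ^ (-4 - β) := by
  have key : (fun u : ℝ => (1 - u) ^ (-β) - (1 + u) ^ (-β) - 2 * β * u
      - β * (β + 1) * (β + 2) / 3 * u ^ 3) =O[𝓝 0] fun u => u ^ 5 := by
    refine ((one_sub_rpow_taylor (-β)).sub (one_add_rpow_taylor (-β))).congr_left fun u => ?_
    ring
  refine (isBigO_rpow_mul_comp_inv (1 - β) key).congr' ?_ ?_
  · filter_upwards [eventually_gt_atTop 1] with t ht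
    have h0 : 0 < t := by linarith
    rw [mS_one_eq ht, show -2 - β = 1 - β - (3:ℕ) by push_cast; ring, rpow_sub h0 (1 - β) (3:ℕ),
      rpow_natCast, inv_pow]
    ring
  · filter_upwards with t
    congr 1; push_cast; ring

lemma eS_aux_isBigO (hβ : β ∈ Ioo (0:ℝ) 1) : (fun u : ℝ =>
    ((1 - u) ^ (2 - β) - (1 + u) ^ (2 - β)) / (2 - β)
      + u * ((1 - u) ^ (1 - β) + (1 + u) ^ (1 - β)) / (1 - β) - 2 * β * u / (1 - β)
      - (-(β * (β + 2) / 3) * u ^ 3)) =O[𝓝 0] fun u => u ^ 5 := by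
  have h1 : 1 - β ≠ 0 := by linarith [hβ.2]
  have h2 : 2 - β ≠ 0 := by linarith [hβ.2]
  have hu : (fun u : ℝ => u) =O[𝓝 0] fun u => (1:ℝ) := by
    simpa using (continuous_id.tendsto (0:ℝ)).isBigO_one ℝ
  have t1 := ((one_sub_rpow_taylor (2 - β)).sub (one_add_rpow_taylor (2 - β))).const_mul_left
    (2 - β)⁻¹
  have t2 := ((hu.mul ((one_sub_rpow_taylor (1 - β)).add (one_add_rpow_taylor (1 - β)))).congr_right
    (fun u => one_mul (u ^ 5))).const_mul_left (1 - β)⁻¹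
  refine ((t1.add t2).add (isBigO_pow_of_le (le_refl 5)
    (-(β * (β + 1) * (β + 2) / 12)))).congr_left fun u => ?_
  field_simp
  ring

lemma rS_aux_isBigO (hβ : β ∈ Ioo (0:ℝ) 1) : (fun u : ℝ =>
    -(((1 - u) ^ (2 - β) - (1 + u) ^ (2 - β)) / (2 - β)
      + u * ((1 - u) ^ (1 - β) + (1 + u) ^ (1 - β)) / (1 - β) - 2 * β * u / (1 - β))
    + (1 - β) * ((((1 - u) ^ (4 - β) - (1 + u) ^ (4 - β)) / (4 - β)
      + u * ((1 - u) ^ (3 - β) + (1 + u) ^ (3 - β)) / (3 - β)) / (2 - β)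
    + (u * ((1 - u) ^ (3 - β) + (1 + u) ^ (3 - β)) / (3 - β)
      + u ^ 2 * ((1 - u) ^ (2 - β) - (1 + u) ^ (2 - β)) / (2 - β)) / (1 - β)
      - 2 * β * u / ((1 - β) * (3 - β)))) =O[𝓝 0] fun u => u ^ 5 := by
  have h1 : 1 - β ≠ 0 := by linarith [hβ.2]
  have h2 : 2 - β ≠ 0 := by linarith [hβ.2]
  have h3 : 3 - β ≠ 0 := by linarith [hβ.2]
  have h4 : 4 - β ≠ 0 := by linarith [hβ.2]
  have hu : (fun u : ℝ => u) =O[𝓝 0] fun u => (1:ℝ) := by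
    simpa using (continuous_id.tendsto (0:ℝ)).isBigO_one ℝ
  have hu2 : (fun u : ℝ => u ^ 2) =O[𝓝 0] fun u => (1:ℝ) := by
    simpa using ((continuous_pow 2).tendsto (0:ℝ)).isBigO_one ℝ
  have t1 := (eS_aux_isBigO hβ).const_mul_left (-1)
  have t4 := ((one_sub_rpow_taylor (4 - β)).sub (one_add_rpow_taylor (4 - β))).const_mul_left
    ((1 - β) * ((4 - β)⁻¹ * (2 - β)⁻¹))
  have t3 := ((hu.mul ((one_sub_rpow_taylor (3 - β)).add (one_add_rpow_taylor (3 - β)))).congr_right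
    (fun u => one_mul (u ^ 5))).const_mul_left ((1 - β) * ((3 - β)⁻¹ * ((2 - β)⁻¹ + (1 - β)⁻¹)))
  have t2 := ((hu2.mul ((one_sub_rpow_taylor (2 - β)).sub
    (one_add_rpow_taylor (2 - β)))).congr_right
    (fun u => one_mul (u ^ 5))).const_mul_left ((1 - β) * ((2 - β)⁻¹ * (1 - β)⁻¹))
  refine ((((t1.add t4).add t3).add t2).add (isBigO_pow_of_le (le_refl 5)
    ((1 - β) * β * (1 + 2 * β) / 12))).congr_left fun u => ?_
  field_simp
  ring

lemma tendsto_of_isBigO_rpow {g : ℝ → ℝ} {p : ℝ} (hp : p < 0)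
    (h : g =O[atTop] fun t : ℝ => t ^ p) : Tendsto g atTop (𝓝 0) := by
  refine h.trans_tendsto ?_
  have := tendsto_rpow_neg_atTop (y := -p) (by linarith)
  simpa using this

lemma tendsto_eS (hβ : β ∈ Ioo (0:ℝ) 1) : Tendsto (eS β 1) atTop (𝓝 0) := by
  have key := ((eS_aux_isBigO hβ).trans ((isBigO_pow_of_le (show 3 ≤ 5 by norm_num) 1).congr_left
    fun u => one_mul (u ^ 5))).add
      (isBigO_pow_of_le (le_refl 3) (-(β * (β + 2) / 3)))
  refine tendsto_of_isBigO_rpow (p := 2 - β - (3:ℕ)) (by push_cast; linarith [hβ.1])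
    ((isBigO_rpow_mul_comp_inv (2 - β) key).congr' ?_ EventuallyEq.rfl)
  filter_upwards [eventually_gt_atTop 1] with t ht
  rw [eS_one_eq ht]
  ring

lemma tendsto_rS (hβ : β ∈ Ioo (0:ℝ) 1) : Tendsto (rS β 1) atTop (𝓝 0) := by
  refine tendsto_of_isBigO_rpow (p := 4 - β - (5:ℕ)) (by push_cast; linarith [hβ.1])
    ((isBigO_rpow_mul_comp_inv (4 - β) (rS_aux_isBigO hβ)).congr' ?_ EventuallyEq.rfl)
  filter_upwards [eventually_gt_atTop 1] with t ht
  have h0 : 0 < t := by linarith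
  have h2 : t ^ (2 - β) = t ^ (4 - β) * t⁻¹ ^ 2 := by
    rw [show 2 - β = 4 - β - (2:ℕ) by push_cast; ring, rpow_sub h0, rpow_natCast, div_eq_mul_inv,
      inv_pow]
  have h3 : t ^ 2 * t⁻¹ ^ 2 = 1 := by field_simp
  rw [rS, eS_one_eq ht, fS_one_eq ht, h2]
  linear_combination (t ^ (4 - β) * (((1 - t⁻¹) ^ (2 - β) - (1 + t⁻¹) ^ (2 - β)) / (2 - β)
      + t⁻¹ * ((1 - t⁻¹) ^ (1 - β) + (1 + t⁻¹) ^ (1 - β)) / (1 - β)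
      - 2 * β * t⁻¹ / (1 - β))) * h3
end asymptotics

lemma nonneg_of_hasDerivAt_nonneg {φ φ' : ℝ → ℝ} (h0 : φ 0 = 0)
    (hc : ContinuousOn φ (Ico 0 1)) (hd : ∀ u ∈ Ioo (0:ℝ) 1, HasDerivAt φ (φ' u) u)
    (hp : ∀ u ∈ Ioo (0:ℝ) 1, 0 ≤ φ' u) : ∀ u ∈ Ico (0:ℝ) 1, 0 ≤ φ u := by
  have hm : MonotoneOn φ (Ico 0 1) := by
    refine monotoneOn_of_deriv_nonneg (convex_Ico 0 1) hc ?_ ?_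
    · rw [interior_Ico]
      exact fun u hu => (hd u hu).differentiableAt.differentiableWithinAt
    · rw [interior_Ico]
      intro u hu
      rw [(hd u hu).deriv]
      exact hp u hu
  intro u hu
  rw [← h0]
  exact hm ⟨le_refl 0, by norm_num⟩ hu hu.1

section signs
variable {β : ℝ}

lemma hasDerivAt_one_sub_rpow (p : ℝ) {u : ℝ} (hu : u < 1) :
    HasDerivAt (fun u : ℝ => (1 - u) ^ p) (-p * (1 - u) ^ (p - 1)) u := by
  have := ((hasDerivAt_id u).const_sub 1).rpow_const (p := p) (Or.inl (by simp; linarith))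
  simpa using this

lemma continuousOn_one_sub_rpow (p : ℝ) : ContinuousOn (fun u : ℝ => (1 - u) ^ p) (Ico 0 1) :=
  fun _ hu => (hasDerivAt_one_sub_rpow p hu.2).continuousAt.continuousWithinAt

lemma continuousOn_one_add_rpow (p : ℝ) : ContinuousOn (fun u : ℝ => (1 + u) ^ p) (Ico 0 1) := by
  refine ContinuousOn.rpow_const (by fun_prop) fun u hu => Or.inl ?_
  linarith [hu.1]

lemma one_add_rpow_le {p : ℝ} (hp : p ≤ 0) {u : ℝ} (hu : u ∈ Ico (0:ℝ) 1) :
    (1 + u) ^ p ≤ (1 - u) ^ p :=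
  rpow_le_rpow_of_nonpos (by linarith [hu.2]) (by linarith [hu.1]) hp

lemma rpow_diff_le (hβ : β ∈ Ioo (0:ℝ) 1) : ∀ u ∈ Ico (0:ℝ) 1,
    0 ≤ β * u * ((1 - u) ^ (-β - 1) + (1 + u) ^ (-β - 1)) - ((1 - u) ^ (-β) - (1 + u) ^ (-β)) := by
  refine nonneg_of_hasDerivAt_nonneg (φ' := fun u => β * u * ((β + 1) *
    ((1 - u) ^ (-β - 2) - (1 + u) ^ (-β - 2)))) (by simp) ?_ ?_ ?_
  · have h1 := continuousOn_one_sub_rpow (-β - 1)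
    have h2 := continuousOn_one_add_rpow (-β - 1)
    have h3 := continuousOn_one_sub_rpow (-β)
    have h4 := continuousOn_one_add_rpow (-β)
    fun_prop
  · intro u hu
    have := (((hasDerivAt_id u).const_mul β).mul ((hasDerivAt_one_sub_rpow (-β - 1) hu.2).add
      (hasDerivAt_right_rpow (-β - 1) hu.1))).sub
      ((hasDerivAt_one_sub_rpow (-β) hu.2).sub (hasDerivAt_right_rpow (-β) hu.1))
    refine this.congr_deriv ?_
    simp only [id, show -β - 1 - 1 = -β - 2 by ring]
    simp
    ring
  · intro u hu
    have := one_add_rpow_le (p := -β - 2) (by linarith [hβ.1]) ⟨hu.1.le, hu.2⟩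
    have h1 := hβ.1
    have h2 := hu.1
    have h3 := sub_nonneg.2 this
    positivity

lemma nu_deriv_nonneg (hβ : β ∈ Ioo (0:ℝ) 1) : ∀ u ∈ Ico (0:ℝ) 1,
    0 ≤ 2 * β / (1 - β) * ((1 - u) ^ (1 - β) + (1 + u) ^ (1 - β) - 2)
      - (1 - β) * u * ((1 - u) ^ (-β) - (1 + u) ^ (-β))
      + β * u ^ 2 * ((1 - u) ^ (-β - 1) + (1 + u) ^ (-β - 1)) := by
  have h1 : 1 - β ≠ 0 := by linarith [hβ.2]
  refine nonneg_of_hasDerivAt_nonneg (φ' := fun u => (1 + β) *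
    ((β * u * ((1 - u) ^ (-β - 1) + (1 + u) ^ (-β - 1)) - ((1 - u) ^ (-β) - (1 + u) ^ (-β)))
      + β * u ^ 2 * ((1 - u) ^ (-β - 2) - (1 + u) ^ (-β - 2)))) (by norm_num) ?_ ?_ ?_
  · have h1 := continuousOn_one_sub_rpow (-β - 1)
    have h2 := continuousOn_one_add_rpow (-β - 1)
    have h3 := continuousOn_one_sub_rpow (-β)
    have h4 := continuousOn_one_add_rpow (-β)
    have h5 := continuousOn_one_sub_rpow (1 - β)
    have h6 := continuousOn_one_add_rpow (1 - β)
    fun_prop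
  · intro u hu
    have := (((((hasDerivAt_one_sub_rpow (1 - β) hu.2).add
      (hasDerivAt_right_rpow (1 - β) hu.1)).sub_const 2).const_mul (2 * β / (1 - β))).sub
      (((hasDerivAt_id u).const_mul (1 - β)).mul
      ((hasDerivAt_one_sub_rpow (-β) hu.2).sub (hasDerivAt_right_rpow (-β) hu.1)))).add
      (((hasDerivAt_pow 2 u).const_mul β).mul ((hasDerivAt_one_sub_rpow (-β - 1) hu.2).add
      (hasDerivAt_right_rpow (-β - 1) hu.1)))
    refine this.congr_deriv ?_
    simp only [id, show -β - 1 - 1 = -β - 2 by ring, show 1 - β - 1 = -β by ring]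
    simp
    field_simp
    ring
  · intro u hu
    have h0 := rpow_diff_le hβ u ⟨hu.1.le, hu.2⟩
    have := one_add_rpow_le (p := -β - 2) (by linarith [hβ.1]) ⟨hu.1.le, hu.2⟩
    have h1 := hβ.1
    have h2 := hu.1
    have h3 := sub_nonneg.2 this
    positivity

lemma nu_nonneg (hβ : β ∈ Ioo (0:ℝ) 1) : ∀ u ∈ Ico (0:ℝ) 1,
    0 ≤ (1 + β) * (((1 - u) ^ (2 - β) - (1 + u) ^ (2 - β)) / (2 - β)
      + u * ((1 - u) ^ (1 - β) + (1 + u) ^ (1 - β)) / (1 - β) - 2 * β * u / (1 - β))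
      + ((1 - u) ^ (-β) - (1 + u) ^ (-β) - 2 * β * u) := by
  have h1 : 1 - β ≠ 0 := by linarith [hβ.2]
  have h2 : 2 - β ≠ 0 := by linarith [hβ.2]
  refine nonneg_of_hasDerivAt_nonneg (φ' := _) (by simp) ?_ ?_
    (fun u hu => nu_deriv_nonneg hβ u ⟨hu.1.le, hu.2⟩)
  · have h1 := continuousOn_one_sub_rpow (2 - β)
    have h2 := continuousOn_one_add_rpow (2 - β)
    have h3 := continuousOn_one_sub_rpow (-β)
    have h4 := continuousOn_one_add_rpow (-β)
    have h5 := continuousOn_one_sub_rpow (1 - β)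
    have h6 := continuousOn_one_add_rpow (1 - β)
    fun_prop
  · intro u hu
    have := ((((((hasDerivAt_one_sub_rpow (2 - β) hu.2).sub
      (hasDerivAt_right_rpow (2 - β) hu.1)).div_const (2 - β)).add
      (((hasDerivAt_id u).mul ((hasDerivAt_one_sub_rpow (1 - β) hu.2).add
      (hasDerivAt_right_rpow (1 - β) hu.1))).div_const (1 - β))).sub
      (((hasDerivAt_id u).const_mul (2 * β)).div_const (1 - β))).const_mul (1 + β)).add
      (((hasDerivAt_one_sub_rpow (-β) hu.2).sub (hasDerivAt_right_rpow (-β) hu.1)).sub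
      ((hasDerivAt_id u).const_mul (2 * β)))
    refine this.congr_deriv ?_
    have e1 : ∀ a : ℝ, 0 < a → a ^ (-β) = a * a ^ (-β - 1) := fun a ha => by
      rw [rpow_sub ha, rpow_one]; field_simp
    simp only [id, Pi.add_apply, show 1 - β - 1 = -β by ring,
      show 2 - β - 1 = 1 - β by ring]
    have e2 : ∀ a : ℝ, 0 < a → a ^ (1 - β) = a * a ^ (-β) := fun a ha => by
      rw [sub_eq_add_neg, rpow_add ha, rpow_one]
    have ha : 0 < 1 - u := by linarith [hu.2]
    have hb : 0 < 1 + u := by linarith [hu.1]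
    rw [e2 _ ha, e2 _ hb, e1 _ ha, e1 _ hb]
    simp
    field_simp
    ring

lemma nS_one_nonpos (hβ : β ∈ Ioo (0:ℝ) 1) {t : ℝ} (ht : 1 < t) : nS β 1 t ≤ 0 := by
  have h0 : 0 < t := by linarith
  have h := nu_nonneg hβ t⁻¹ ⟨by positivity, inv_lt_one_of_one_lt₀ ht⟩
  have h2 : t ^ (2 - β) = t * t ^ (1 - β) := by
    rw [show 2 - β = 1 + (1 - β) by ring, rpow_add h0, rpow_one]
  have hp : 0 < t ^ (2 - β) := rpow_pos_of_pos h0 _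
  rw [nS, eS_one_eq ht, mS_one_eq ht]
  have := mul_nonneg hp.le h
  rw [h2] at this ⊢
  linarith

/-- `nS β (-1)` on `(0, 1)`, written so as to be continuous at `0`. -/
def nLeft (β t : ℝ) : ℝ :=
  -(1 + β) * eS β (-1) t - t ^ 2 * ((1 - t) ^ (-β) - (1 + t) ^ (-β)) + 2 * β * t ^ (1 - β)

lemma nS_neg_one_eq {t : ℝ} (ht : 0 < t) : nS β (-1) t = nLeft β t := by
  have : t ^ (1 - β) = t * t ^ (-β) := by rw [sub_eq_add_neg, rpow_add ht, rpow_one]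
  rw [nS, nLeft, mS, this, show -1 * (t - 1) = 1 - t by ring]
  ring

lemma hasDerivAt_nLeft (hβ : β ∈ Ioo (0:ℝ) 1) {t : ℝ} (ht : t ∈ Ioo (0:ℝ) 1) :
    HasDerivAt (nLeft β) (4 * β * t ^ (-β) - (3 + β) * t * ((1 - t) ^ (-β) - (1 + t) ^ (-β))
      - β * t ^ 2 * ((1 - t) ^ (-β - 1) + (1 + t) ^ (-β - 1))) t := by
  have := (((hasDerivAt_eS hβ (Or.inr rfl) ht.1 (by linarith [ht.2])).const_mul (-(1 + β))).sub
    ((hasDerivAt_pow 2 t).mul ((hasDerivAt_one_sub_rpow (-β) ht.2).sub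
      (hasDerivAt_right_rpow (-β) ht.1)))).add
      ((hasDerivAt_self_rpow (1 - β) ht.1).const_mul (2 * β))
  refine this.congr_deriv ?_
  simp only [show 1 - β - 1 = -β by ring, mS, show -1 * (t - 1) = 1 - t by ring]
  simp
  ring

lemma concaveOn_nLeft (hβ : β ∈ Ioo (0:ℝ) 1) : ConcaveOn ℝ (Ico 0 1) (nLeft β) := by
  refine concaveOn_of_hasDerivWithinAt2_nonpos (convex_Ico 0 1)
    (f' := fun t => 4 * β * t ^ (-β) - (3 + β) * t * ((1 - t) ^ (-β) - (1 + t) ^ (-β))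
      - β * t ^ 2 * ((1 - t) ^ (-β - 1) + (1 + t) ^ (-β - 1)))
    (f'' := fun t => -(4 * β ^ 2 * t ^ (-β - 1)) - (3 + β) * (((1 - t) ^ (-β) - (1 + t) ^ (-β))
      + t * (β * ((1 - t) ^ (-β - 1) + (1 + t) ^ (-β - 1))))
      - (2 * β * t * ((1 - t) ^ (-β - 1) + (1 + t) ^ (-β - 1))
      + β * t ^ 2 * ((β + 1) * ((1 - t) ^ (-β - 2) - (1 + t) ^ (-β - 2))))) ?_ ?_ ?_ ?_
  · have h1 := (continuous_eS (σ := -1) hβ).continuousOn (s := Ico 0 1)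
    have h2 : ContinuousOn (fun t : ℝ => t ^ (1 - β)) (Ico 0 1) :=
      (continuous_rpow_const (by linarith [hβ.2])).continuousOn
    have h3 := continuousOn_one_sub_rpow (-β)
    have h4 := continuousOn_one_add_rpow (-β)
    unfold nLeft
    fun_prop
  · rw [interior_Ico]
    exact fun t ht => (hasDerivAt_nLeft hβ ht).hasDerivWithinAt
  · rw [interior_Ico]
    intro t ht
    have := (((hasDerivAt_self_rpow (-β) ht.1).const_mul (4 * β)).sub
      (((hasDerivAt_id t).const_mul (3 + β)).mul ((hasDerivAt_one_sub_rpow (-β) ht.2).sub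
      (hasDerivAt_right_rpow (-β) ht.1)))).sub (((hasDerivAt_pow 2 t).const_mul β).mul
      ((hasDerivAt_one_sub_rpow (-β - 1) ht.2).add (hasDerivAt_right_rpow (-β - 1) ht.1)))
    refine (this.congr_deriv ?_).hasDerivWithinAt
    simp only [id, show -β - 1 - 1 = -β - 2 by ring]
    simp
    ring
  · rw [interior_Ico]
    intro t ht
    have ht' : t ∈ Ico (0:ℝ) 1 := ⟨ht.1.le, ht.2⟩
    have k0 := hβ.1
    have k1 := ht.1
    have k2 := sub_nonneg.2 (one_add_rpow_le (p := -β - 2) (by linarith) ht')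
    have k3 := sub_nonneg.2 (one_add_rpow_le (p := -β) (by linarith) ht')
    have k4 : 0 < 1 - t := by linarith [ht.2]
    have p1 : 0 ≤ 4 * β ^ 2 * t ^ (-β - 1) := by positivity
    have p2 : 0 ≤ (3 + β) * (((1 - t) ^ (-β) - (1 + t) ^ (-β))
      + t * (β * ((1 - t) ^ (-β - 1) + (1 + t) ^ (-β - 1)))) := by positivity
    have p3 : 0 ≤ 2 * β * t * ((1 - t) ^ (-β - 1) + (1 + t) ^ (-β - 1))
      + β * t ^ 2 * ((β + 1) * ((1 - t) ^ (-β - 2) - (1 + t) ^ (-β - 2))) := by positivity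
    linarith

lemma nLeft_slope (hβ : β ∈ Ioo (0:ℝ) 1) {s t : ℝ} (hs : 0 < s) (hst : s ≤ t) (ht : t < 1) :
    s * nLeft β t ≤ t * nLeft β s := by
  have h1 : 1 - β ≠ 0 := by linarith [hβ.2]
  have h0 : nLeft β 0 = 0 := by simp [nLeft, eS_zero hβ, h1]
  have ht0 : 0 < t := by linarith
  have := (concaveOn_nLeft hβ).2 (show (0:ℝ) ∈ Ico 0 1 from ⟨le_refl 0, by norm_num⟩)
    (show t ∈ Ico (0:ℝ) 1 from ⟨ht0.le, ht⟩)
    (show 0 ≤ 1 - s / t by rw [sub_nonneg, div_le_one ht0]; exact hst)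
    (show 0 ≤ s / t by positivity) (by ring)
  simp only [h0, smul_eq_mul, mul_zero, zero_add] at this
  rw [div_mul_cancel₀ _ ht0.ne', div_mul_eq_mul_div, div_le_iff₀ ht0] at this
  linarith

/-- A non-increasing weight can be replaced by a constant when integrated against `nS`. -/
lemma exists_const_crossing (hβ : β ∈ Ioo (0:ℝ) 1) {d : ℝ → ℝ} {C : ℝ}
    (hd : AntitoneOn d (Ioi 0)) (hC : ∀ t, 0 < t → d t ≤ C) :
    ∃ k : ℝ, (∀ t ∈ Ioo (0:ℝ) 1, k * nS β (-1) t ≤ d t * nS β (-1) t) ∧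
      ∀ t, 1 < t → k * nS β 1 t ≤ d t * nS β 1 t := by
  by_cases hpos : ∀ t ∈ Ioo (0:ℝ) 1, 0 ≤ nLeft β t
  · refine ⟨d 1, fun t ht => ?_, fun t ht => ?_⟩
    · rw [nS_neg_one_eq ht.1]
      exact mul_le_mul_of_nonneg_right (hd ht.1 (mem_Ioi.2 one_pos) ht.2.le) (hpos t ht)
    · exact mul_le_mul_of_nonpos_right (hd (mem_Ioi.2 one_pos) (mem_Ioi.2 (by linarith)) ht.le)
        (nS_one_nonpos hβ ht)
  push Not at hpos
  obtain ⟨b, hb, hbn⟩ := hpos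
  by_cases hneg : ∀ t ∈ Ioo (0:ℝ) 1, nLeft β t ≤ 0
  · refine ⟨C, fun t ht => ?_, fun t ht => ?_⟩
    · rw [nS_neg_one_eq ht.1]
      exact mul_le_mul_of_nonpos_right (hC t ht.1) (hneg t ht)
    · exact mul_le_mul_of_nonpos_right (hC t (by linarith)) (nS_one_nonpos hβ ht)
  push Not at hneg
  obtain ⟨a, ha, han⟩ := hneg
  obtain ⟨c, hc, hc0⟩ : ∃ c ∈ Ioo (0:ℝ) 1, nLeft β c = 0 := by
    have hcont : ContinuousOn (nLeft β) (Ioo 0 1) :=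
      fun t ht => (hasDerivAt_nLeft hβ ht).continuousAt.continuousWithinAt
    exact isPreconnected_Ioo.intermediate_value hb ha hcont ⟨hbn.le, han.le⟩
  refine ⟨d c, fun t ht => ?_, fun t ht => ?_⟩
  · rw [nS_neg_one_eq ht.1]
    rcases le_total t c with h | h
    · have := nLeft_slope hβ ht.1 h hc.2
      rw [hc0, mul_zero] at this
      exact mul_le_mul_of_nonneg_right (hd ht.1 hc.1 h) (nonneg_of_mul_nonneg_right this hc.1)
    · have := nLeft_slope hβ hc.1 h ht.2
      rw [hc0, mul_zero] at this
      exact mul_le_mul_of_nonpos_right (hd hc.1 ht.1 h) (by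
        by_contra hlt
        push Not at hlt
        have := mul_pos hc.1 hlt
        linarith)
  · exact mul_le_mul_of_nonpos_right (hd hc.1 (mem_Ioi.2 (by linarith)) (by linarith [hc.2]))
        (nS_one_nonpos hβ ht)
end signs

section kernel
variable {β : ℝ}

/-- The rescaled kernel of `Tfr`, with the opposite sign. -/
def mker (β t : ℝ) : ℝ := t * |1 - t| ^ (-β) - t * (1 + t) ^ (-β) - 2 * β * t ^ (-β)

lemma mker_of_lt {t : ℝ} (ht : t < 1) : mker β t = mS β (-1) t := by
  rw [mker, mS, abs_of_pos (by linarith), show -1 * (t - 1) = 1 - t by ring]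

lemma mker_of_gt {t : ℝ} (ht : 1 < t) : mker β t = mS β 1 t := by
  rw [mker, mS, abs_of_neg (by linarith), show -(1 - t) = 1 * (t - 1) by ring]

lemma measurable_mker : Measurable (mker β) := by
  unfold mker
  fun_prop

lemma exists_mker_tail (β : ℝ) : ∃ K C : ℝ, 1 < K ∧ 0 ≤ C ∧ ∀ t, K ≤ t →
    |mker β t - β * (β + 1) * (β + 2) / 3 * t ^ (-2 - β)| ≤ C * t ^ (-4 - β) := by
  obtain ⟨C, hC0, hC⟩ := (mS_isBigO (β := β)).exists_nonneg
  obtain ⟨K, hK⟩ := eventually_atTop.1 hC.bound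
  refine ⟨max K 2, C, lt_max_of_lt_right one_lt_two, hC0, fun t ht => ?_⟩
  have h2 : 2 ≤ t := (le_max_right _ _).trans ht
  have := hK t ((le_max_left _ _).trans ht)
  rwa [norm_eq_abs, norm_eq_abs, abs_of_nonneg (rpow_nonneg (by linarith) _),
    ← mker_of_gt (by linarith)] at this

lemma integrableOn_abs_rpow (hβ : β ∈ Ioo (0:ℝ) 1) (K : ℝ) (hK : 1 ≤ K) :
    IntegrableOn (fun t : ℝ => |1 - t| ^ (-β)) (Ioc 0 K) := by
  have h1 : IntervalIntegrable (fun t : ℝ => |1 - t| ^ (-β)) volume 0 1 := by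
    have := (intervalIntegral.intervalIntegrable_rpow' (a := 1) (b := 0)
      (show -1 < -β by linarith [hβ.2])).comp_sub_left 1
    simp only [sub_self, sub_zero] at this
    refine this.congr_uIoo fun t ht => ?_
    rw [uIoo_of_le zero_le_one] at ht
    simp only [abs_of_pos (sub_pos.2 ht.2)]
  have h2 : IntervalIntegrable (fun t : ℝ => |1 - t| ^ (-β)) volume 1 K := by
    have := (intervalIntegral.intervalIntegrable_rpow' (a := 0) (b := K - 1)
      (show -1 < -β by linarith [hβ.2])).comp_sub_right 1
    simp only [zero_add, sub_add_cancel] at this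
    refine this.congr_uIoo fun t ht => ?_
    rw [uIoo_of_le hK] at ht
    simp only [abs_sub_comm 1 t, abs_of_pos (sub_pos.2 ht.1)]
  exact (intervalIntegrable_iff_integrableOn_Ioc_of_le (by linarith)).1 (h1.trans h2)

lemma integrableOn_mker_Ioc (hβ : β ∈ Ioo (0:ℝ) 1) (K : ℝ) (hK : 1 ≤ K) :
    IntegrableOn (mker β) (Ioc 0 K) := by
  have h0 : 0 ≤ K := by linarith
  have h1 : IntegrableOn (fun t : ℝ => t * |1 - t| ^ (-β)) (Ioc 0 K) :=
    (((intervalIntegrable_iff_integrableOn_Ioc_of_le h0).2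
      (integrableOn_abs_rpow hβ K hK)).continuousOn_mul continuousOn_id).1.mono_set
      (by simp)
  have h2 : IntegrableOn (fun t : ℝ => t * (1 + t) ^ (-β)) (Ioc 0 K) := by
    refine (ContinuousOn.integrableOn_Icc ?_).mono_set Ioc_subset_Icc_self
    exact continuousOn_id.mul (ContinuousOn.rpow_const (by fun_prop)
      fun t ht => Or.inl (by linarith [ht.1]))
  have h3 : IntegrableOn (fun t : ℝ => 2 * β * t ^ (-β)) (Ioc 0 K) :=
    ((intervalIntegrable_iff_integrableOn_Ioc_of_le h0).1
      (intervalIntegral.intervalIntegrable_rpow' (by linarith [hβ.2]))).const_mul _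
  exact (h1.sub h2).sub h3

lemma integrableOn_mker (hβ : β ∈ Ioo (0:ℝ) 1) : IntegrableOn (mker β) (Ioi 0) := by
  obtain ⟨K, C, hK, -, hC⟩ := exists_mker_tail β
  have h0 : 0 < K := by linarith
  rw [← Ioc_union_Ioi_eq_Ioi h0.le]
  refine (integrableOn_mker_Ioc hβ K hK.le).union ?_
  have h1 : IntegrableOn (fun t : ℝ => β * (β + 1) * (β + 2) / 3 * t ^ (-2 - β)) (Ioi K) :=
    (integrableOn_Ioi_rpow_of_lt (by linarith [hβ.1]) h0).const_mul _
  have h2 : IntegrableOn (fun t : ℝ => mker β t - β * (β + 1) * (β + 2) / 3 * t ^ (-2 - β))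
      (Ioi K) := by
    refine ((integrableOn_Ioi_rpow_of_lt (show -4 - β < -1 by linarith [hβ.1]) h0).const_mul
      C).mono' ?_ ?_
    · exact (measurable_mker.sub (by fun_prop)).aestronglyMeasurable
    · filter_upwards [ae_restrict_mem measurableSet_Ioi] with t ht using hC t (le_of_lt ht)
  exact (h2.add h1).congr_fun (fun t _ => by simp) measurableSet_Ioi

lemma integral_Ioi_nonpos_of_hasDeriv_right {φ g₁ g₂ g₁' g₂' : ℝ → ℝ}
    (hφ : IntegrableOn φ (Ioi 0)) (hc₁ : ContinuousOn g₁ (Icc 0 1)) (hc₂ : ContinuousOn g₂ (Ici 1))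
    (hd₁ : ∀ x ∈ Ioo (0:ℝ) 1, HasDerivWithinAt g₁ (g₁' x) (Ioi x) x)
    (hd₂ : ∀ x, 1 < x → HasDerivWithinAt g₂ (g₂' x) (Ioi x) x)
    (h₁ : ∀ x ∈ Ioo (0:ℝ) 1, φ x ≤ g₁' x) (h₂ : ∀ x, 1 < x → φ x ≤ g₂' x)
    (h0 : g₁ 0 = 0) (h1 : g₁ 1 = g₂ 1) (hlim : Tendsto g₂ atTop (𝓝 0)) :
    ∫ x in Ioi 0, φ x ≤ 0 := by
  have hI : ∀ a b : ℝ, 0 ≤ a → IntegrableOn φ (Icc a b) := fun a b ha =>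
    (integrableOn_Icc_iff_integrableOn_Ioc (by simp)).2 (hφ.mono_set fun x hx => lt_of_le_of_lt ha hx.1)
  have hii : ∀ a b : ℝ, 0 ≤ a → a ≤ b → IntervalIntegrable φ volume a b := fun a b ha hab =>
    (intervalIntegrable_iff_integrableOn_Icc_of_le hab).2 (hI a b ha)
  refine le_of_tendsto_of_tendsto (intervalIntegral_tendsto_integral_Ioi 0 hφ tendsto_id) hlim ?_
  filter_upwards [eventually_ge_atTop 1] with R hR
  have e1 := intervalIntegral.integral_le_sub_of_hasDeriv_right_of_le zero_le_one hc₁ hd₁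
    (hI 0 1 le_rfl) h₁
  have e2 := intervalIntegral.integral_le_sub_of_hasDeriv_right_of_le hR
    (hc₂.mono Icc_subset_Ici_self) (fun x hx => hd₂ x hx.1) (hI 1 R zero_le_one)
    (fun x hx => h₂ x hx.1)
  have e3 := intervalIntegral.integral_add_adjacent_intervals (hii 0 1 le_rfl zero_le_one)
    (hii 1 R zero_le_one hR)
  simp only [id]
  linarith

lemma integral_mker (hβ : β ∈ Ioo (0:ℝ) 1) : ∫ t in Ioi 0, mker β t = 0 := by
  have hl : ∀ t ∈ Ioo (0:ℝ) 1, HasDerivAt (eS β (-1)) (mker β t) t := fun t ht => by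
    rw [mker_of_lt ht.2]
    exact hasDerivAt_eS hβ (Or.inr rfl) ht.1 (by linarith [ht.2])
  have hr : ∀ t, 1 < t → HasDerivAt (eS β 1) (mker β t) t := fun t ht => by
    rw [mker_of_gt ht]
    exact hasDerivAt_eS hβ (Or.inl rfl) (by linarith) (by linarith)
  apply le_antisymm
  · exact integral_Ioi_nonpos_of_hasDeriv_right (integrableOn_mker hβ)
      (continuous_eS hβ).continuousOn (continuous_eS hβ).continuousOn
      (fun t ht => (hl t ht).hasDerivWithinAt) (fun t ht => (hr t ht).hasDerivWithinAt)
      (fun _ _ => le_rfl) (fun _ _ => le_rfl) (eS_zero hβ) (eS_one hβ) (tendsto_eS hβ)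
  · have := integral_Ioi_nonpos_of_hasDeriv_right (integrableOn_mker hβ).neg
      (continuous_eS hβ).neg.continuousOn (continuous_eS hβ).neg.continuousOn
      (fun t ht => (hl t ht).neg.hasDerivWithinAt) (fun t ht => (hr t ht).neg.hasDerivWithinAt)
      (fun _ _ => le_rfl) (fun _ _ => le_rfl) (by simp [eS_zero hβ])
      (by simp [eS_one (σ := -1) hβ]) (neg_zero (G := ℝ) ▸ (tendsto_eS hβ).neg)
    simp only [Pi.neg_apply, integral_neg] at this
    linarith

end kernel

/-- The properties of `1 - f`, for `f` in the invariant set, that control `Tfr α f`. -/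
structure IsProfile (h : ℝ → ℝ) (C : ℝ) : Prop where
  cont : Continuous h
  zero : h 0 = 0
  nonneg : ∀ x, 0 ≤ x → 0 ≤ h x
  le_one : ∀ x, 0 ≤ x → h x ≤ 1
  mono : MonotoneOn h (Ici 0)
  concave : ConcaveOn ℝ (Ici 0) fun s => h (√s)
  le_sq : ∀ x, 0 ≤ x → h x ≤ C * x ^ 2

/-- The right derivative of `s ↦ h (√s)`. -/
def sqrtDeriv (h : ℝ → ℝ) (s : ℝ) : ℝ := derivWithin (fun s => h (√s)) (Ioi s) s

namespace IsProfile
variable {h : ℝ → ℝ} {C : ℝ}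

lemma hasDerivWithinAt_sqrt (H : IsProfile h C) {s : ℝ} (hs : 0 < s) :
    HasDerivWithinAt (fun s => h (√s)) (sqrtDeriv h s) (Ioi s) s := by
  have := (H.concave.neg.hasDerivWithinAt_rightDeriv_of_mem_interior
    (show s ∈ interior (Ici 0) by rwa [interior_Ici])).neg.differentiableWithinAt
  simp only [neg_neg] at this
  exact this.hasDerivWithinAt

lemma antitoneOn_sqrtDeriv (H : IsProfile h C) : AntitoneOn (sqrtDeriv h) (Ioi 0) := by
  have := H.concave.neg.monotoneOn_rightDeriv
  rw [interior_Ici] at this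
  intro s hs t ht hst
  have := this hs ht hst
  simp only [derivWithin.neg] at this
  exact neg_le_neg_iff.1 this

lemma slope_le (H : IsProfile h C) {s r : ℝ} (hs : 0 < s) (hr : s < r) : (h √r - h √s) / (r - s) ≤ h √s / s := by
  have := H.concave.slope_anti_adjacent (mem_Ici.2 le_rfl) (mem_Ici.2 (hs.trans hr).le) hs hr
  simpa [H.zero] using this

lemma sqrtDeriv_le (H : IsProfile h C) {s : ℝ} (hs : 0 < s) : sqrtDeriv h s ≤ C := by
  have h1 : sqrtDeriv h s ≤ h √s / s := by
    refine le_of_tendsto ((hasDerivWithinAt_iff_tendsto_slope' self_notMem_Ioi).1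
      (H.hasDerivWithinAt_sqrt hs)) ?_
    filter_upwards [self_mem_nhdsWithin] with r hr
    rw [slope_def_field]
    exact H.slope_le hs hr
  refine h1.trans ((div_le_iff₀ hs).2 ?_)
  simpa [sq_sqrt hs.le] using H.le_sq (√s) (sqrt_nonneg s)

lemma hasDerivWithinAt_scale (H : IsProfile h C) {x t : ℝ} (hx : 0 < x) (ht : 0 < t) :
    HasDerivWithinAt (fun t => h (x * t)) (2 * x ^ 2 * t * sqrtDeriv h (x ^ 2 * t ^ 2))
      (Ioi t) t := by
  have h1 : HasDerivAt (fun t : ℝ => x ^ 2 * t ^ 2) (x ^ 2 * (2 * t)) t := by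
    simpa using (hasDerivAt_pow 2 t).const_mul (x ^ 2)
  have h2 := (H.hasDerivWithinAt_sqrt (show 0 < x ^ 2 * t ^ 2 by positivity)).comp t
    h1.hasDerivWithinAt (s := Ioi t) (fun r hr => by
      have : t < r := hr
      simp only [mem_Ioi]
      gcongr)
  have e : ∀ r : ℝ, 0 < r → h (x * r) = ((fun s => h (√s)) ∘ fun t => x ^ 2 * t ^ 2) r := by
    intro r hr
    simp only [Function.comp, ← mul_pow, sqrt_sq (mul_pos hx hr).le]
  refine (h2.congr (fun r hr => e r (ht.trans hr)) (e t ht)).congr_deriv ?_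
  ring

lemma sub_le (H : IsProfile h C) {x y t : ℝ} (hx : 0 < x) (hxy : x ≤ y) (ht : 0 < t) :
    h (y * t) - h (x * t) ≤ (y - x) * (y + x) / x ^ 2 := by
  rcases hxy.eq_or_lt with rfl | hlt
  · simp
  have hxt := mul_pos hx ht
  have hy := hx.trans hlt
  have hs := H.slope_le (s := (x * t) ^ 2) (r := (y * t) ^ 2) (by positivity) (by gcongr)
  rw [sqrt_sq hxt.le, sqrt_sq (by positivity)] at hs
  have hd : 0 < (y * t) ^ 2 - (x * t) ^ 2 := sub_pos.2 (by gcongr)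
  have h1 := hs.trans (div_le_div_of_nonneg_right (H.le_one _ hxt.le) (by positivity))
  rw [div_le_iff₀ hd] at h1
  refine h1.trans (le_of_eq ?_)
  field_simp
  ring

lemma abs_sub_le (H : IsProfile h C) {x₀ x y t : ℝ} (h0 : 0 < x₀) (hx : x ∈ Ioo (x₀ / 2) (3 * x₀ / 2))
    (hy : y ∈ Ioo (x₀ / 2) (3 * x₀ / 2)) (ht : 0 < t) :
    |h (x * t) - h (y * t)| ≤ 12 / x₀ * |x - y| := by
  wlog hxy : y ≤ x generalizing x y
  · rw [abs_sub_comm, abs_sub_comm x]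
    exact this hy hx (le_of_not_ge hxy)
  have hy0 : 0 < y := by linarith [hy.1]
  have hm : h (y * t) ≤ h (x * t) := H.mono (mem_Ici.2 (by positivity))
    (mem_Ici.2 (mul_nonneg (hy0.le.trans hxy) ht.le)) (by gcongr)
  rw [abs_of_nonneg (sub_nonneg.2 hm), abs_of_nonneg (sub_nonneg.2 hxy)]
  refine (H.sub_le hy0 hxy ht).trans ?_
  rw [div_le_iff₀ (by positivity)]
  have e1 : x + y ≤ 3 * x₀ := by linarith [hx.2, hy.2]
  have e2 : (x₀ / 2) ^ 2 ≤ y ^ 2 := by gcongr; exact hy.1.le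
  calc (x - y) * (x + y) ≤ (x - y) * (3 * x₀) := by gcongr
    _ = 12 / x₀ * (x - y) * (x₀ / 2) ^ 2 := by field_simp; ring
    _ ≤ _ := by
      have : 0 ≤ x - y := by linarith
      gcongr

lemma ae_hasDerivAt (H : IsProfile h C) {x : ℝ} (hx : 0 < x) : ∀ᵐ t ∂volume.restrict (Ioi (0:ℝ)),
    HasDerivAt (fun y => h (y * t)) (2 * x * t ^ 2 * sqrtDeriv h (x ^ 2 * t ^ 2)) x := by
  have hm : MonotoneOn (fun t => h (x * t)) (Ioi 0) := fun s hs t ht hst =>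
    H.mono (mul_pos hx hs).le (mul_pos hx ht).le (by gcongr)
  filter_upwards [hm.ae_differentiableWithinAt measurableSet_Ioi,
    ae_restrict_mem measurableSet_Ioi] with t hd ht
  have ht0 : 0 < t := ht
  have hv := (hd.differentiableAt (Ioi_mem_nhds ht)).hasDerivAt
  have he := (uniqueDiffWithinAt_Ioi t).eq_deriv _ hv.hasDerivWithinAt
    (H.hasDerivWithinAt_scale hx ht0)
  rw [he] at hv
  have hs : HasDerivAt (fun y : ℝ => y * t / x) (t / x) x := by
    simpa using ((hasDerivAt_id x).mul_const t).div_const x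
  have hv' : HasDerivAt (fun t => h (x * t)) (2 * x ^ 2 * t * sqrtDeriv h (x ^ 2 * t ^ 2))
      (x * t / x) := by rwa [mul_div_cancel_left₀ t hx.ne']
  refine ((HasDerivAt.comp (h₂ := fun t => h (x * t)) (h := fun y => y * t / x) x hv' hs).congr_of_eventuallyEq ?_).congr_deriv ?_
  · filter_upwards with y
    simp only [Function.comp]
    congr 1
    field_simp
  · field_simp

lemma antitoneOn_comp (H : IsProfile h C) {x : ℝ} (hx : 0 < x) :
    AntitoneOn (fun t => sqrtDeriv h (x ^ 2 * t ^ 2)) (Ioi 0) := fun s hs t ht hst => by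
  have hs0 : 0 < s := hs
  have ht0 : 0 < t := ht
  exact H.antitoneOn_sqrtDeriv (mem_Ioi.2 (by positivity)) (mem_Ioi.2 (by positivity))
    (by gcongr)

lemma integrable_mul (H : IsProfile h C) {β x : ℝ} (hβ : β ∈ Ioo (0:ℝ) 1) (hx : 0 < x) :
    IntegrableOn (fun t => h (x * t) * mker β t) (Ioi 0) := by
  refine (integrableOn_mker hβ).bdd_mul (c := 1) ?_ ?_
  · exact (H.cont.comp (continuous_const_mul x)).aestronglyMeasurable
  · filter_upwards [ae_restrict_mem measurableSet_Ioi] with t ht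
    have := (mul_pos hx (mem_Ioi.1 ht)).le
    rw [norm_eq_abs, abs_of_nonneg (H.nonneg _ this)]
    exact H.le_one _ this

lemma hasDerivAt_integral (H : IsProfile h C) {β x : ℝ} (hβ : β ∈ Ioo (0:ℝ) 1) (hx : 0 < x) :
    IntegrableOn (fun t => 2 * x * t ^ 2 * sqrtDeriv h (x ^ 2 * t ^ 2) * mker β t) (Ioi 0) ∧
    HasDerivAt (fun x => ∫ t in Ioi 0, h (x * t) * mker β t)
      (∫ t in Ioi 0, 2 * x * t ^ 2 * sqrtDeriv h (x ^ 2 * t ^ 2) * mker β t) x := by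
  refine hasDerivAt_integral_of_dominated_loc_of_lip (s := Ioo (x / 2) (3 * x / 2))
    (bound := fun t => 12 / x * |mker β t|) (F := fun x t => h (x * t) * mker β t)
    (Ioo_mem_nhds (by linarith) (by linarith)) ?_ (H.integrable_mul hβ hx) ?_ ?_ ?_ ?_
  · filter_upwards [lt_mem_nhds hx] with y hy using (H.integrable_mul hβ hy).1
  · exact (((by fun_prop : AEMeasurable (fun t : ℝ => 2 * x * t ^ 2) _).mul
      (aemeasurable_restrict_of_antitoneOn measurableSet_Ioi (H.antitoneOn_comp hx))).mul
      measurable_mker.aemeasurable).aestronglyMeasurable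
  · filter_upwards [ae_restrict_mem measurableSet_Ioi] with t ht
    refine LipschitzOnWith.of_dist_le_mul fun y hy z hz => ?_
    rw [dist_eq, dist_eq, ← sub_mul, abs_mul, coe_nnabs,
      abs_of_nonneg (show 0 ≤ 12 / x * |mker β t| by positivity)]
    have := mul_le_mul_of_nonneg_right (H.abs_sub_le hx hy hz ht) (abs_nonneg (mker β t))
    linarith
  · exact (integrableOn_mker hβ).abs.const_mul _
  · filter_upwards [H.ae_hasDerivAt hx] with t ht using ht.mul_const _

lemma mul_deriv_integral_le (H : IsProfile h C) {β x : ℝ} (hβ : β ∈ Ioo (0:ℝ) 1) (hx : 0 < x) :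
    x * ∫ t in Ioi 0, 2 * x * t ^ 2 * sqrtDeriv h (x ^ 2 * t ^ 2) * mker β t ≤
      (1 + β) * ∫ t in Ioi 0, h (x * t) * mker β t := by
  obtain ⟨k, hk₁, hk₂⟩ := exists_const_crossing hβ (H.antitoneOn_comp hx) (C := C)
    fun t ht => H.sqrtDeriv_le (by positivity)
  have hI := (H.hasDerivAt_integral hβ hx).1.const_mul x
  have hJ := (H.integrable_mul hβ hx).const_mul (1 + β)
  rw [← sub_nonpos, ← integral_const_mul, ← integral_const_mul, ← integral_sub hI hJ]
  have hcu : Continuous fun t => h (x * t) := H.cont.comp (continuous_const_mul x)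
  have hcont : ∀ σ, Continuous fun t => -(2 * x ^ 2 * k) * rS β σ t
      - (1 + β) * (h (x * t) * eS β σ t) := fun σ => by
    have h1 := continuous_eS (σ := σ) hβ
    have h2 := continuous_rS (σ := σ) hβ
    exact (h2.const_mul _).sub ((hcu.mul h1).const_mul _)
  have hder : ∀ σ t, (σ = 1 ∨ σ = -1) → 0 < t → 0 < σ * (t - 1) →
      HasDerivWithinAt (fun t => -(2 * x ^ 2 * k) * rS β σ t - (1 + β) * (h (x * t) * eS β σ t))
        (-(2 * x ^ 2 * k) * (t * nS β σ t) - (1 + β) * (2 * x ^ 2 * t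
          * sqrtDeriv h (x ^ 2 * t ^ 2) * eS β σ t + h (x * t) * mS β σ t)) (Ioi t) t :=
    fun σ t hσ ht h => ((hasDerivAt_rS hβ hσ ht h).hasDerivWithinAt.const_mul _).sub
      (((H.hasDerivWithinAt_scale hx ht).mul
        (hasDerivAt_eS hβ hσ ht h).hasDerivWithinAt).const_mul _)
  have hle : ∀ σ t, 0 < t →
      k * nS β σ t ≤ sqrtDeriv h (x ^ 2 * t ^ 2) * nS β σ t →
      x * (2 * x * t ^ 2 * sqrtDeriv h (x ^ 2 * t ^ 2) * mS β σ t)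
        - (1 + β) * (h (x * t) * mS β σ t) ≤
      -(2 * x ^ 2 * k) * (t * nS β σ t) - (1 + β) * (2 * x ^ 2 * t
          * sqrtDeriv h (x ^ 2 * t ^ 2) * eS β σ t + h (x * t) * mS β σ t) := by
    intro σ t ht hk
    have := mul_le_mul_of_nonneg_left hk (show 0 ≤ 2 * x ^ 2 * t by positivity)
    have e : t * mS β σ t = -nS β σ t - (1 + β) * eS β σ t := by rw [nS]; ring
    have e2 : x * (2 * x * t ^ 2 * sqrtDeriv h (x ^ 2 * t ^ 2) * mS β σ t) =
      2 * x ^ 2 * t * sqrtDeriv h (x ^ 2 * t ^ 2) * (t * mS β σ t) := by ring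
    rw [e2, e]
    linarith
  refine integral_Ioi_nonpos_of_hasDeriv_right (hI.sub hJ)
    (hcont (-1)).continuousOn (hcont 1).continuousOn
    (fun t ht => hder (-1) t (Or.inr rfl) ht.1 (by linarith [ht.2]))
    (fun t ht => hder 1 t (Or.inl rfl) (by linarith) (by linarith)) ?_ ?_ ?_ ?_ ?_
  · intro t ht
    simp only [mker_of_lt ht.2]
    exact hle (-1) t ht.1 (hk₁ t ht)
  · intro t ht
    simp only [mker_of_gt ht]
    exact hle 1 t (by linarith) (hk₂ t ht)
  · simp [rS_zero hβ, H.zero]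
  · simp only [eS_one (σ := -1) hβ, rS_one (σ := -1) hβ]
  · have h1 : Tendsto (fun t => h (x * t) * eS β 1 t) atTop (𝓝 0) := by
      refine squeeze_zero_norm' ?_ (by simpa using (tendsto_eS hβ).norm)
      filter_upwards [eventually_ge_atTop 0] with t ht
      rw [norm_mul, norm_eq_abs, abs_of_nonneg (H.nonneg _ (by positivity))]
      exact mul_le_of_le_one_left (norm_nonneg _) (H.le_one _ (by positivity))
    simpa using ((tendsto_rS hβ).const_mul (-(2 * x ^ 2 * k))).sub (h1.const_mul (1 + β))

end IsProfile

lemma C0_pos {α : ℝ} (hα : α ∈ Ioo (0:ℝ) (1/2)) : 0 < C0 α := by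
  have h1 := Real.Gamma_pos_of_pos (show 0 < 1 + α by linarith [hα.1])
  have h2 := Real.Gamma_pos_of_pos (show 0 < 1 - α by linarith [hα.2])
  have h3 := pi_pos
  unfold C0
  positivity

lemma C3_pos {α : ℝ} (hα : α ∈ Ioo (0:ℝ) (1/2)) : 0 < C3 α := by
  obtain ⟨ha, hb⟩ := hα
  have h1 := Real.Gamma_pos_of_pos ha
  have h2 := Real.Gamma_pos_of_pos (show 0 < 2 - α by linarith)
  have h3 := pi_pos
  have h4 : (4:ℝ) < 4 ^ (1 + α) := by
    simpa using rpow_lt_rpow_of_exponent_lt (show (1:ℝ) < 4 by norm_num)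
      (show (1:ℝ) < 1 + α by linarith)
  have h5 : 0 < α - 4 * α ^ 3 := by
    have : 0 < α * ((1 - 2 * α) * (1 + 2 * α)) :=
      mul_pos ha (mul_pos (by linarith) (by linarith))
    linarith
  have h6 : 0 < 5 - 2 * α := by linarith
  have h7 : 0 < 3 - 2 * α := by linarith
  have h8 : 0 < 1 - 2 * α := by linarith
  have h9 : 0 < (4:ℝ) ^ (1 + α) - 4 + α - 4 * α ^ 3 := by linarith
  unfold C3
  positivity

lemma one_lt_deltaU_add {α t0 : ℝ} (hα : α ∈ Ioo (0:ℝ) (1/2))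
    (h : (1 - 2 * α) / (2 * α * C3 α) < t0 ^ (1/2 - α)) : 1 < deltaU α t0 + 2 * α := by
  obtain ⟨ha, hb⟩ := hα
  have hC := C3_pos ⟨ha, hb⟩
  rw [div_lt_iff₀ (by positivity)] at h
  have hy : 0 < C3 α * t0 ^ (1/2 - α) :=
    (mul_pos_iff_of_pos_left (show 0 < 2 * α by linarith)).1 (by linarith)
  rw [← sub_lt_iff_lt_add, deltaU, lt_div_iff₀ (by linarith)]
  linarith

lemma W1.isProfile {α t0 δl : ℝ} {f : ℝ → ℝ} (ht0 : 1 < t0) (hδ : 1/2 ≤ δl)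
    (hf : W1 α t0 δl f) : IsProfile (fun x => 1 - f x) (δl / t0 ^ 2) := by
  obtain ⟨hc, -, -, h0, hn, ha, hconv, hl, -, -⟩ := hf
  have h1 : ∀ x, 0 ≤ x → f x ≤ 1 := fun x hx => h0 ▸ ha (mem_Ici.2 le_rfl) hx hx
  refine ⟨continuous_const.sub hc, by simp [h0], fun x hx => sub_nonneg.2 (h1 x hx),
    fun x hx => by linarith [hn x hx], fun x hx y hy hxy => sub_le_sub_left (ha hx hy hxy) 1,
    (concaveOn_const 1 (convex_Ici 0)).sub hconv, fun x _ => ?_⟩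
  have hs : 0 < 1 + x ^ 2 / t0 ^ 2 := by positivity
  have h2 := hl x
  rw [fl, rpow_def_of_pos hs] at h2
  have h3 := add_one_le_exp (log (1 + x ^ 2 / t0 ^ 2) * -δl)
  have h4 := mul_le_mul_of_nonneg_left (log_le_sub_one_of_pos hs) (show 0 ≤ δl by linarith)
  have h5 : δl * (1 + x ^ 2 / t0 ^ 2 - 1) = δl / t0 ^ 2 * x ^ 2 := by ring
  linarith

lemma integrableOn_Ioi_of_le {g : ℝ → ℝ} {A B p q : ℝ} (hg : Measurable g) (hp : -1 < p)
    (hq : q < -1) (h1 : ∀ t ∈ Ioc (0:ℝ) 1, |g t| ≤ A * t ^ p)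
    (h2 : ∀ t, 1 < t → |g t| ≤ B * t ^ q) : IntegrableOn g (Ioi 0) := by
  rw [← Ioc_union_Ioi_eq_Ioi zero_le_one]
  refine IntegrableOn.union ?_ ?_
  · refine (((intervalIntegrable_iff_integrableOn_Ioc_of_le zero_le_one).1
      (intervalIntegral.intervalIntegrable_rpow' hp)).const_mul A).mono' hg.aestronglyMeasurable ?_
    filter_upwards [ae_restrict_mem measurableSet_Ioc] with t ht using h1 t ht
  · refine ((integrableOn_Ioi_rpow_of_lt hq one_pos).const_mul B).mono' hg.aestronglyMeasurable ?_
    filter_upwards [ae_restrict_mem measurableSet_Ioi] with t ht using h2 t ht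

lemma W1.integrableOn_mul_rpow {α t0 δl : ℝ} {f : ℝ → ℝ} (hα : α ∈ Ioo (0:ℝ) (1/2))
    (ht : (1 - 2 * α) / (2 * α * C3 α) < t0 ^ (1/2 - α)) (hf : W1 α t0 δl f) :
    IntegrableOn (fun ξ => f ξ * ξ ^ (-(2 * α))) (Ioi 0) := by
  obtain ⟨hc, -, -, h0, hn, ha, -, -, hu, -⟩ := hf
  refine integrableOn_Ioi_of_le (A := 1) (B := t0 ^ deltaU α t0) (p := -(2 * α))
    (q := -(deltaU α t0) + -(2 * α)) (hc.measurable.mul (by fun_prop)) (by linarith [hα.2])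
    (by linarith [one_lt_deltaU_add hα ht]) (fun t ht => ?_) (fun t ht => ?_)
  · have hp := rpow_nonneg ht.1.le (-(2 * α))
    rw [abs_of_nonneg (mul_nonneg (hn t ht.1.le) hp)]
    exact mul_le_mul_of_nonneg_right (h0 ▸ ha (mem_Ici.2 le_rfl) ht.1.le ht.1.le) hp
  · have ht0 : 0 < t := by linarith
    have hp := rpow_nonneg ht0.le (-(2 * α))
    have := hu t
    rw [fu, if_neg ht0.ne', abs_of_pos ht0] at this
    rw [abs_of_nonneg (mul_nonneg (hn t ht0.le) hp), rpow_add ht0, ← mul_assoc]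
    exact mul_le_mul_of_nonneg_right (this.trans (min_le_right _ _)) hp

lemma Tfr_eq {α : ℝ} {f : ℝ → ℝ} {C : ℝ} (hα : α ∈ Ioo (0:ℝ) (1/2))
    (H : IsProfile (fun x => 1 - f x) C) {x : ℝ} (hx : 0 < x) :
    Tfr α f x = C0 α / α * (x ^ (1 - 2 * α) *
      ∫ t in Ioi 0, (1 - f (x * t)) * mker (2 * α) t) := by
  have hβ : 2 * α ∈ Ioo (0:ℝ) 1 := ⟨by linarith [hα.1], by linarith [hα.2]⟩
  rw [Tfr, if_neg hx.ne', abs_of_pos hx]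
  congr 1
  have hs := integral_comp_mul_left_Ioi (fun ξ => f ξ * (4 * α * ξ ^ (-(2 * α)) -
    (ξ / x) * (|(x - ξ)| ^ (-(2 * α)) - (x + ξ) ^ (-(2 * α))))) 0 hx
  rw [mul_zero, smul_eq_mul, eq_inv_mul_iff_mul_eq₀ hx.ne'] at hs
  rw [← hs]
  have hpt : ∀ t ∈ Ioi (0:ℝ), f (x * t) * (4 * α * (x * t) ^ (-(2 * α)) -
      (x * t / x) * (|x - x * t| ^ (-(2 * α)) - (x + x * t) ^ (-(2 * α)))) =
      x ^ (-(2 * α)) * ((1 - f (x * t)) * mker (2 * α) t - mker (2 * α) t) := by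
    intro t ht
    have ht0 : 0 < t := ht
    rw [show x - x * t = x * (1 - t) by ring, show x + x * t = x * (1 + t) by ring, abs_mul,
      abs_of_pos hx, mul_rpow hx.le ht0.le, mul_rpow hx.le (abs_nonneg _),
      mul_rpow hx.le (by linarith), mul_div_cancel_left₀ t hx.ne', mker]
    ring
  rw [setIntegral_congr_fun measurableSet_Ioi hpt, integral_const_mul,
    integral_sub (H.integrable_mul hβ hx) (integrableOn_mker hβ), integral_mker hβ, sub_zero,
    ← mul_assoc, sub_eq_add_neg 1, rpow_add hx, rpow_one]

lemma hasDerivAt_Tfr {α : ℝ} {f : ℝ → ℝ} {C : ℝ} (hα : α ∈ Ioo (0:ℝ) (1/2))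
    (H : IsProfile (fun x => 1 - f x) C) {x : ℝ} (hx : 0 < x) :
    ∃ d, HasDerivAt (Tfr α f) d x ∧ x * d ≤ 2 * Tfr α f x := by
  have hβ : 2 * α ∈ Ioo (0:ℝ) 1 := ⟨by linarith [hα.1], by linarith [hα.2]⟩
  have hc : 0 ≤ C0 α / α := div_nonneg (C0_pos hα).le hα.1.le
  refine ⟨_, (((hasDerivAt_self_rpow (1 - 2 * α) hx).mul
    (H.hasDerivAt_integral hβ hx).2).const_mul (C0 α / α)).congr_of_eventuallyEq ?_, ?_⟩
  · filter_upwards [lt_mem_nhds hx] with y hy using Tfr_eq hα H hy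
  · rw [Tfr_eq hα H hx]
    have h1 := H.mul_deriv_integral_le hβ hx
    have h2 : x * x ^ (1 - 2 * α - 1) = x ^ (1 - 2 * α) := by
      rw [rpow_sub_one hx.ne', mul_div_cancel₀ _ hx.ne']
    have h3 := mul_le_mul_of_nonneg_left h1
      (mul_nonneg hc (rpow_nonneg hx.le (1 - 2 * α)))
    linear_combination h3 + C0 α / α * (1 - 2 * α) *
      (∫ t in Ioi 0, (1 - f (x * t)) * mker (2 * α) t) * h2

lemma antitoneOn_Tfr_div_sq {α : ℝ} {f : ℝ → ℝ} {C : ℝ} (hα : α ∈ Ioo (0:ℝ) (1/2))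
    (H : IsProfile (fun x => 1 - f x) C) :
    AntitoneOn (fun x => Tfr α f x / x ^ 2) (Ioi 0) := by
  have key : ∀ x : ℝ, 0 < x → ∃ d, HasDerivAt (fun x => Tfr α f x / x ^ 2) d x ∧ d ≤ 0 := by
    intro x hx
    obtain ⟨d, hd, hle⟩ := hasDerivAt_Tfr hα H hx
    refine ⟨_, hd.div (hasDerivAt_pow 2 x) (by positivity), ?_⟩
    refine div_nonpos_of_nonpos_of_nonneg ?_ (by positivity)
    have := mul_le_mul_of_nonneg_left hle hx.le
    push_cast
    linarith
  refine antitoneOn_of_deriv_nonpos (convex_Ioi 0) ?_ ?_ ?_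
  · intro x hx
    obtain ⟨d, hd, -⟩ := key x hx
    exact hd.continuousAt.continuousWithinAt
  · intro x hx
    obtain ⟨d, hd, -⟩ := key x (interior_subset hx)
    exact hd.differentiableAt.differentiableWithinAt
  · intro x hx
    obtain ⟨d, hd, hle⟩ := key x (interior_subset hx)
    exact hd.deriv.trans_le hle

lemma exists_mker_le {β : ℝ} (hβ : β ∈ Ioo (0:ℝ) 1) : ∃ w : ℝ → ℝ, (∀ t, 0 ≤ w t) ∧
    (∀ t, mker β t ≤ β * (β + 1) * (β + 2) / 3 * t ^ (-2 - β) + w t) ∧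
    IntegrableOn (fun t => t ^ 2 * w t) (Ioi 0) := by
  obtain ⟨K, C, hK, -, hC⟩ := exists_mker_tail β
  have h0 : 0 < K := by linarith
  have hb := hβ.1
  set w : ℝ → ℝ := fun t => max 0 (mker β t - β * (β + 1) * (β + 2) / 3 * t ^ (-2 - β)) with hw
  have hm : Measurable fun t => t ^ 2 * w t := by
    have := measurable_mker (β := β)
    fun_prop
  have hw0 : ∀ t, 0 ≤ w t := fun t => le_max_left _ _
  refine ⟨w, hw0, fun t => sub_le_iff_le_add'.1 (le_max_right _ _), ?_⟩
  rw [← Ioc_union_Ioi_eq_Ioi h0.le]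
  refine IntegrableOn.union ?_ ?_
  · refine ((integrableOn_mker_Ioc hβ K hK.le).abs.const_mul (K ^ 2)).mono'
      hm.aestronglyMeasurable ?_
    filter_upwards [ae_restrict_mem measurableSet_Ioc] with t ht
    rw [norm_eq_abs, abs_of_nonneg (mul_nonneg (sq_nonneg t) (hw0 t))]
    have h1 : w t ≤ |mker β t| := by
      refine max_le (abs_nonneg _) (le_trans ?_ (le_abs_self _))
      have := rpow_nonneg ht.1.le (-2 - β)
      rw [sub_le_self_iff]
      positivity
    have h2 : t ^ 2 ≤ K ^ 2 := pow_le_pow_left₀ ht.1.le ht.2 2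
    exact mul_le_mul h2 h1 (hw0 t) (sq_nonneg K)
  · refine ((integrableOn_Ioi_rpow_of_lt (show -2 - β < -1 by linarith) h0).const_mul C).mono'
      hm.aestronglyMeasurable ?_
    filter_upwards [ae_restrict_mem measurableSet_Ioi] with t ht
    have ht0 : 0 < t := h0.trans ht
    rw [norm_eq_abs, abs_of_nonneg (mul_nonneg (sq_nonneg t) (hw0 t))]
    have h1 : w t ≤ C * t ^ (-4 - β) :=
      max_le ((abs_nonneg _).trans (hC t (le_of_lt ht))) ((le_abs_self _).trans (hC t (le_of_lt ht)))
    have h2 : t ^ (-2 - β) = t ^ 2 * t ^ (-4 - β) := by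
      rw [← rpow_natCast, ← rpow_add ht0]
      congr 1
      push_cast
      ring
    calc t ^ 2 * w t ≤ t ^ 2 * (C * t ^ (-4 - β)) := by gcongr
      _ = _ := by rw [h2]; ring

namespace IsProfile
variable {h : ℝ → ℝ} {C : ℝ}

lemma integrableOn_mul_rpow (H : IsProfile h C) {β : ℝ} (hβ : β ∈ Ioo (0:ℝ) 1) :
    IntegrableOn (fun ξ => h ξ * ξ ^ (-2 - β)) (Ioi 0) := by
  refine integrableOn_Ioi_of_le (A := C) (B := 1) (p := -β) (q := -2 - β)
    (H.cont.measurable.mul (by fun_prop)) (by linarith [hβ.2]) (by linarith [hβ.1])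
    (fun t ht => ?_) (fun t ht => ?_)
  · have hp := rpow_nonneg ht.1.le (-2 - β)
    rw [abs_of_nonneg (mul_nonneg (H.nonneg t ht.1.le) hp)]
    have e : t ^ (-β) = t ^ 2 * t ^ (-2 - β) := by
      rw [← rpow_natCast, ← rpow_add ht.1]
      congr 1
      push_cast
      ring
    rw [e, ← mul_assoc]
    exact mul_le_mul_of_nonneg_right (H.le_sq t ht.1.le) hp
  · have ht0 : 0 ≤ t := by linarith
    have hp := rpow_nonneg ht0 (-2 - β)
    rw [abs_of_nonneg (mul_nonneg (H.nonneg t ht0) hp)]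
    exact mul_le_mul_of_nonneg_right (H.le_one t ht0) hp

lemma exists_integral_le (H : IsProfile h C) {β : ℝ} (hβ : β ∈ Ioo (0:ℝ) 1) : ∃ B : ℝ, ∀ y, 0 < y →
    ∫ t in Ioi 0, h (y * t) * mker β t ≤
      β * (β + 1) * (β + 2) / 3 * y ^ (1 + β) * (∫ ξ in Ioi 0, h ξ * ξ ^ (-2 - β))
        + B * y ^ 2 := by
  obtain ⟨w, hw0, hw, hwi⟩ := exists_mker_le hβ
  refine ⟨C * ∫ t in Ioi 0, t ^ 2 * w t, fun y hy => ?_⟩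
  have hpt : ∀ t ∈ Ioi (0:ℝ), y ^ (2 + β) * (h (y * t) * (y * t) ^ (-2 - β)) =
      h (y * t) * t ^ (-2 - β) := by
    intro t ht
    have : y ^ (2 + β) * y ^ (-2 - β) = 1 := by
      rw [← rpow_add hy, show 2 + β + (-2 - β) = 0 by ring, rpow_zero]
    rw [mul_rpow hy.le (le_of_lt ht)]
    linear_combination h (y * t) * t ^ (-2 - β) * this
  have hs := integral_comp_mul_left_Ioi (fun ξ => h ξ * ξ ^ (-2 - β)) 0 hy
  rw [mul_zero, smul_eq_mul] at hs
  have hi : IntegrableOn (fun t => h (y * t) * t ^ (-2 - β)) (Ioi 0) := by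
    refine IntegrableOn.congr_fun ?_ hpt measurableSet_Ioi
    refine Integrable.const_mul ?_ _
    have := (integrableOn_Ioi_comp_mul_left_iff (fun ξ => h ξ * ξ ^ (-2 - β)) 0 hy).2
    rw [mul_zero] at this
    exact this (H.integrableOn_mul_rpow hβ)
  have he : ∫ t in Ioi 0, h (y * t) * t ^ (-2 - β) =
      y ^ (1 + β) * ∫ ξ in Ioi 0, h ξ * ξ ^ (-2 - β) := by
    rw [← setIntegral_congr_fun measurableSet_Ioi hpt, integral_const_mul, hs, ← mul_assoc,
      show 2 + β = (1 + β) + 1 by ring, rpow_add_one hy.ne']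
    field_simp
  calc ∫ t in Ioi 0, h (y * t) * mker β t
      ≤ ∫ t in Ioi 0, (β * (β + 1) * (β + 2) / 3 * (h (y * t) * t ^ (-2 - β))
        + C * y ^ 2 * (t ^ 2 * w t)) := by
        refine setIntegral_mono_on (H.integrable_mul hβ hy)
          ((hi.const_mul _).add (hwi.const_mul _)) measurableSet_Ioi fun t ht => ?_
        have h0 : 0 ≤ y * t := mul_nonneg hy.le (le_of_lt ht)
        have h1 := mul_le_mul_of_nonneg_left (hw t) (H.nonneg _ h0)
        have h2 := mul_le_mul_of_nonneg_right (H.le_sq _ h0) (hw0 t)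
        linarith
    _ = _ := by
        rw [integral_add (hi.const_mul _) (hwi.const_mul _), integral_const_mul,
          integral_const_mul, he]
        ring
end IsProfile

lemma Tfr_div_sq_le {α : ℝ} {f : ℝ → ℝ} {C : ℝ} (hα : α ∈ Ioo (0:ℝ) (1/2))
    (H : IsProfile (fun x => 1 - f x) C) {x : ℝ} (hx : 0 < x) :
    Tfr α f x / x ^ 2 ≤ cfr α f / 2 := by
  have hβ : 2 * α ∈ Ioo (0:ℝ) 1 := ⟨by linarith [hα.1], by linarith [hα.2]⟩
  have hα0 := hα.1
  have hc : 0 ≤ C0 α / α := div_nonneg (C0_pos hα).le hα.1.le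
  obtain ⟨B, hB⟩ := H.exists_integral_le hβ
  have hlim : Tendsto (fun y : ℝ => cfr α f / 2 + C0 α / α * B * y ^ (1 - 2 * α)) (𝓝[>] 0)
      (𝓝 (cfr α f / 2)) := by
    have h1 : Tendsto (fun y : ℝ => y ^ (1 - 2 * α)) (𝓝[>] 0) (𝓝 0) := by
      have := (continuous_rpow_const (q := 1 - 2 * α) (by linarith [hα.2])).tendsto 0
      rw [zero_rpow (by linarith [hα.2])] at this
      exact this.mono_left nhdsWithin_le_nhds
    simpa using (h1.const_mul (C0 α / α * B)).const_add (cfr α f / 2)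
  refine ge_of_tendsto hlim ?_
  filter_upwards [Ioo_mem_nhdsGT hx] with y hy
  have hy0 : 0 < y := hy.1
  refine (antitoneOn_Tfr_div_sq hα H hy0 hx hy.2.le).trans ?_
  simp only
  rw [div_le_iff₀ (by positivity), Tfr_eq hα H hy0]
  have h1 := mul_le_mul_of_nonneg_left (hB y hy0)
    (mul_nonneg hc (rpow_nonneg hy0.le (1 - 2 * α)))
  have h2 : y ^ (1 - 2 * α) * y ^ (1 + 2 * α) = y ^ 2 := by
    rw [← rpow_add hy0, ← rpow_natCast]
    congr 1
    push_cast
    ring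
  have h3 : cfr α f / 2 = C0 α / α * (2 * α * (2 * α + 1) * (2 * α + 2) / 3) *
      ∫ ξ in Ioi 0, (1 - f ξ) * ξ ^ (-2 - 2 * α) := by
    rw [cfr]
    field_simp
    ring
  rw [h3]
  linear_combination h1 + C0 α / α * (2 * α * (2 * α + 1) * (2 * α + 2) / 3) *
      (∫ ξ in Ioi 0, (1 - f ξ) * ξ ^ (-2 - 2 * α)) * h2

lemma Tfr_le_bfr {α : ℝ} {f : ℝ → ℝ} (hα : α ∈ Ioo (0:ℝ) (1/2))
    (hf : ∀ x ∈ Ici (0:ℝ), 0 ≤ f x)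
    (hi : IntegrableOn (fun ξ => f ξ * ξ ^ (-(2 * α))) (Ioi 0)) {x : ℝ} (hx : 0 < x) :
    Tfr α f x ≤ bfr α f := by
  have hα0 := hα.1
  have hc : 0 ≤ C0 α / α := div_nonneg (C0_pos hα).le hα.1.le
  have hb : bfr α f = C0 α / α * ∫ ξ in Ioi 0, 4 * α * (f ξ * ξ ^ (-(2 * α))) := by
    rw [bfr, integral_const_mul]
    field_simp
  have hnn : ∀ ξ ∈ Ioi (0:ℝ), 0 ≤ 4 * α * (f ξ * ξ ^ (-(2 * α))) := fun ξ hξ =>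
    mul_nonneg (by positivity) (mul_nonneg (hf ξ (Ioi_subset_Ici_self hξ)) (rpow_nonneg (le_of_lt hξ) _))
  rw [Tfr, if_neg hx.ne', abs_of_pos hx, hb]
  refine mul_le_mul_of_nonneg_left ?_ hc
  by_cases hint : IntegrableOn (fun ξ => f ξ * (4 * α * ξ ^ (-(2 * α)) -
    (ξ / x) * (|(x - ξ)| ^ (-(2 * α)) - (x + ξ) ^ (-(2 * α))))) (Ioi 0)
  · refine integral_mono_ae hint (hi.const_mul _) ?_
    filter_upwards [ae_restrict_mem measurableSet_Ioi,
      ae_restrict_of_ae (Measure.ae_ne volume x)] with ξ hξ hne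
    have hξ0 : 0 < ξ := hξ
    have h1 : (x + ξ) ^ (-(2 * α)) ≤ |x - ξ| ^ (-(2 * α)) :=
      rpow_le_rpow_of_nonpos (abs_pos.2 (sub_ne_zero.2 hne.symm))
        (abs_le.2 ⟨by linarith, by linarith⟩) (by linarith)
    have h2 := mul_nonneg (hf ξ hξ0.le)
      (mul_nonneg (div_nonneg hξ0.le hx.le) (sub_nonneg.2 h1))
    linarith
  · rw [integral_undef hint]
    exact setIntegral_nonneg measurableSet_Ioi hnn

/-- Consequences of the concavity of `𝔗_α(f)(√·)`: differentiability and
`x 𝔗'(x) ≤ 2 𝔗(x)`, monotonicity of `𝔗(x)/x²`, the bound `𝔗(x)/x² ≤ 𝔠(f)/2`,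
and `𝔗(x) ≤ min(𝔟(f), (𝔠(f)/2)x²)`. -/
theorem Tfr_bounds (α t0 δl : ℝ) (hα : α ∈ Ioo (0:ℝ) (1/2)) (ht0 : 1 < t0)
    (ht1 : max (1 / C3 α) ((1 - 2*α) / (2*α * C3 α)) < t0 ^ (1/2 - α))
    (ht2 : (2:ℝ) ^ ((2:ℝ) ^ α + 2) * Real.Gamma (2 + α) * Real.Gamma (1/2 - α) /
        (3*π*α*Real.Gamma (1 - α)) < t0 ^ (1/2 + α))
    (hδl : 1/2 ≤ δl)
    (hδ1 : (2:ℝ) ^ (2*α) * Real.Gamma (2 + α) * Real.Gamma (1/2 - α) /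
        (3*π*Real.Gamma (1 - α)) ≤
        Real.Gamma (δl + 1) * t0 ^ (2*α - 1) / Real.Gamma (δl + α + 1/2))
    (hδ2 : Real.Gamma (δl + 1) * t0 ^ (2*α - 1) / Real.Gamma (δl + α + 1/2) ≤
        (2:ℝ) ^ (2*α + 1) * Real.Gamma (2 + α) * Real.Gamma (1/2 - α) /
        (3*π*Real.Gamma (1 - α)))
    (f : ℝ → ℝ) (hf : W1 α t0 δl f) :
    (∀ x : ℝ, 0 < x → DifferentiableAt ℝ (Tfr α f) x ∧
      x * deriv (Tfr α f) x ≤ 2 * Tfr α f x) ∧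
    AntitoneOn (fun x => Tfr α f x / x^2) (Ioi (0:ℝ)) ∧
    (∀ x : ℝ, 0 < x → Tfr α f x / x^2 ≤ cfr α f / 2) ∧
    (∀ x : ℝ, 0 < x → Tfr α f x ≤ min (bfr α f) (cfr α f / 2 * x^2)) := by
  have H := hf.isProfile ht0 hδl
  refine ⟨fun x hx => ?_, antitoneOn_Tfr_div_sq hα H, fun x hx => Tfr_div_sq_le hα H hx,
    fun x hx => le_min ?_ ?_⟩
  · obtain ⟨d, hd, hle⟩ := hasDerivAt_Tfr hα H hx
    exact ⟨hd.differentiableAt, hd.deriv.symm ▸ hle⟩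
  · exact Tfr_le_bfr hα hf.2.2.2.2.1
      (hf.integrableOn_mul_rpow hα ((le_max_right _ _).trans_lt ht1)) hx
  · exact (div_le_iff₀ (by positivity)).1 (Tfr_div_sq_le hα H hx)


end GSQGhalfplane
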